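/- Fix β ∈ (−1,1). As Δ = 2−α → 0⁺, the Fisher information of the skewness parameter satisfies (4(1−β²)·log(1/Δ)/Δ)·I_{ββ}(α) → 1, i.e. I_{ββ}(α) = Δ·(1 + o(1)) / (4(1−β²)·log(1/Δ)), where I_{ββ}(α) = ∫_ℝ f_β(x;α,β)² / f(x;α,β) dx. -/

import Mathlib

open MeasureTheory Filter Set Topology Real

/-- Shift parameter ζ = −β·tan(πα/2) in Zolotarev's (M) parameterization. -/
noncomputable def zetaPar (α β : ℝ) : ℝ := -β * Real.tan (Real.pi * α / 2)

/-- Standard stable density in Zolotarev's (M) parameterization, via the inversion formula. -/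
noncomputable def stableDensity (α β x : ℝ) : ℝ :=
  (1 / Real.pi) *
    (∫ t in Set.Ioi (0 : ℝ),
      Complex.exp (-(Complex.I * (t : ℂ) * (x : ℂ))) *
        Complex.exp (-(((t ^ α : ℝ) : ℂ)) *
          (1 + Complex.I * (β : ℂ) * ((Real.tan (Real.pi * α / 2) : ℝ) : ℂ) *
            (((t ^ (1 - α) : ℝ) : ℂ) - 1)))).re

/-- The N(0,2) density f(y;2). -/
noncomputable def normalDensity (y : ℝ) : ℝ :=
  (1 / (2 * Real.sqrt Real.pi)) * Real.exp (-(y ^ 2) / 4)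

/-- Partial derivative of the stable density with respect to α. -/
noncomputable def fAlpha (α β x : ℝ) : ℝ := deriv (fun a : ℝ => stableDensity a β x) α

/-- Partial derivative of the stable density with respect to β. -/
noncomputable def fBeta (α β x : ℝ) : ℝ := deriv (fun b : ℝ => stableDensity α b x) β

/-- Derivative of the stable density in x. -/
noncomputable def fX (α β x : ℝ) : ℝ := deriv (stableDensity α β) x

/-- The scale score numerator f_σ = −f − x·f′. -/
noncomputable def fSig (α β x : ℝ) : ℝ := -stableDensity α β x - x * fX α β x

lemma integrableOn_comp_exp (c : ℝ) (hc : 0 < c) :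
    Integrable (fun s : ℝ => Real.exp s * Real.exp (-c * Real.exp s)) := by
  have himg : Real.exp '' univ = Ioi 0 := by rw [image_univ, Real.range_exp]
  have h := (integrableOn_image_iff_integrableOn_abs_deriv_smul (s := univ) (f := Real.exp)
    (f' := Real.exp) MeasurableSet.univ
    (fun x _ => (Real.hasDerivAt_exp x).hasDerivWithinAt) Real.exp_injective.injOn
    (fun t : ℝ => Real.exp (-c * t))).1 (by
      rw [himg]; exact exp_neg_integrableOn_Ioi 0 hc)
  rw [integrableOn_univ] at h
  simpa [abs_of_pos (Real.exp_pos _)] using h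

lemma integral_comp_exp_sub (G : ℝ → ℂ) :
    ∫ s : ℝ, (Real.exp s : ℂ) * G s = ∫ u in Ioi (0:ℝ), G (Real.log u) := by
  have himg : Real.exp '' univ = Ioi 0 := by rw [image_univ, Real.range_exp]
  have h := (integral_image_eq_integral_abs_deriv_smul (s := univ) (f := Real.exp)
    (f' := Real.exp) MeasurableSet.univ
    (fun x _ => (Real.hasDerivAt_exp x).hasDerivWithinAt) Real.exp_injective.injOn
    (fun t : ℝ => G (Real.log t)))
  rw [himg] at h
  rw [h]
  simp [abs_of_pos (Real.exp_pos _)]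

lemma rayRot (H : ℂ → ℂ) (hH : Differentiable ℂ H) (p q c C : ℝ) (hpq : p ≤ q) (hc : 0 < c)
    (hb : ∀ s φ : ℝ, p ≤ φ → φ ≤ q →
      ‖H (s - φ * Complex.I)‖ ≤ C * Real.exp (-c * Real.exp s)) :
    ∫ u in Ioi (0:ℝ), H (Real.log u - p * Complex.I) * Complex.exp (-p * Complex.I) =
    ∫ u in Ioi (0:ℝ), H (Real.log u - q * Complex.I) * Complex.exp (-q * Complex.I) := by
  set G : ℂ → ℂ := fun w => H w * Complex.exp w with hG
  have hGd : Differentiable ℂ G := by fun_prop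
  have hGb : ∀ s φ : ℝ, p ≤ φ → φ ≤ q →
      ‖G (s - φ * Complex.I)‖ ≤ C * (Real.exp s * Real.exp (-c * Real.exp s)) := by
    intro s φ h1 h2
    have := hb s φ h1 h2
    have he : ‖Complex.exp (s - φ * Complex.I)‖ = Real.exp s := by
      rw [Complex.norm_exp]; simp
    rw [hG]; simp only [norm_mul, he]
    nlinarith [Real.exp_pos s]
  have hline : ∀ φ : ℝ, p ≤ φ → φ ≤ q → Integrable (fun s : ℝ => G (s - φ * Complex.I)) := by
    intro φ h1 h2
    refine ((integrableOn_comp_exp c hc).const_mul C).mono' ?_ ?_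
    · exact (hGd.continuous.comp (by fun_prop)).aestronglyMeasurable
    · exact Eventually.of_forall (fun s => hGb s φ h1 h2)
  have hsub : ∀ φ : ℝ, ∫ u in Ioi (0:ℝ), H (Real.log u - φ * Complex.I) * Complex.exp (-φ * Complex.I)
      = ∫ s : ℝ, G (s - φ * Complex.I) := by
    intro φ
    rw [← integral_comp_exp_sub (fun s => H (s - φ * Complex.I) * Complex.exp (-φ * Complex.I))]
    congr 1; ext s
    simp only [hG]
    rw [sub_eq_add_neg, Complex.exp_add]; push_cast; ring_nf
  rw [hsub, hsub]
  have hlim : ∀ φ : ℝ, p ≤ φ → φ ≤ q → Tendsto (fun n : ℝ => ∫ s in (-n)..n, G (s - φ * Complex.I)) atTop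
      (𝓝 (∫ s : ℝ, G (s - φ * Complex.I))) := fun φ h1 h2 =>
    intervalIntegral_tendsto_integral (hline φ h1 h2) tendsto_neg_atTop_atBot tendsto_id
  have hvert : ∀ s : ℝ, ‖∫ y in (-q)..(-p), G (s + y * Complex.I)‖ ≤
      C * (Real.exp s * Real.exp (-c * Real.exp s)) * |(-p) - (-q)| := by
    intro s
    apply intervalIntegral.norm_integral_le_of_norm_le_const
    intro y hy
    rw [uIoc_of_le (by linarith)] at hy
    have := hGb s (-y) (by linarith [hy.2]) (by linarith [hy.1])
    simpa using this
  have hrect : ∀ n : ℝ, (∫ s in (-n)..n, G (s - q * Complex.I)) - (∫ s in (-n)..n, G (s - p * Complex.I))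
     + Complex.I • (∫ y in (-q)..(-p), G (n + y * Complex.I))
     - Complex.I • (∫ y in (-q)..(-p), G ((-n : ℝ) + y * Complex.I)) = 0 := by
    intro n
    have := Complex.integral_boundary_rect_eq_zero_of_differentiableOn G (⟨-n, -q⟩) (⟨n, -p⟩)
      hGd.differentiableOn
    simpa [sub_eq_add_neg] using this
  have hz : Tendsto (fun t : ℝ => t * Real.exp (-c * t)) atTop (𝓝 0) := by
    have := Real.tendsto_pow_mul_exp_neg_atTop_nhds_zero 1
    have h2 := (this.comp (tendsto_id.const_mul_atTop hc)).const_mul (1/c)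
    simp only [mul_zero] at h2
    refine h2.congr (fun t => ?_)
    simp only [Function.comp, pow_one, id]
    field_simp
  have hz1 : Tendsto (fun n : ℝ => C * (Real.exp n * Real.exp (-c * Real.exp n)) * |(-p) - (-q)|) atTop (𝓝 0) := by
    have := ((hz.comp Real.tendsto_exp_atTop).const_mul C).mul_const |(-p) - (-q)|
    simpa using this
  have hz2 : Tendsto (fun n : ℝ => C * (Real.exp (-n) * Real.exp (-c * Real.exp (-n))) * |(-p) - (-q)|) atTop (𝓝 0) := by
    have h0 : Tendsto (fun n : ℝ => Real.exp (-n)) atTop (𝓝 0) := Real.tendsto_exp_neg_atTop_nhds_zero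
    have hcont : Continuous (fun t : ℝ => C * (t * Real.exp (-c * t)) * |(-p) - (-q)|) := by fun_prop
    have := (hcont.tendsto 0).comp h0
    simpa [Function.comp_def] using this
  have v1 := squeeze_zero_norm (fun n => hvert n) hz1
  have v2 := squeeze_zero_norm (fun n => hvert (-n)) hz2
  have hfin := (((hlim q hpq le_rfl).sub (hlim p le_rfl hpq)).add (v1.const_smul Complex.I)).sub
    (v2.const_smul Complex.I)
  have hfin2 := hfin.congr (f₂ := fun _ => (0:ℂ)) hrect
  have := tendsto_nhds_unique hfin2 tendsto_const_nhds
  simp only [smul_zero, add_zero, sub_zero] at this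
  exact (sub_eq_zero.1 this).symm

noncomputable def tauP (Δ : ℝ) : ℝ := Real.tan (Real.pi * Δ / 2)

noncomputable def AA (Δ b : ℝ) (w : ℂ) : ℂ :=
  -(1 + Complex.I * b * tauP Δ) * Complex.exp ((2 - Δ) * w) + Complex.I * b * tauP Δ * Complex.exp w

noncomputable def Hf (Δ b x : ℝ) (w : ℂ) : ℂ :=
  Complex.exp (-(Complex.I * x * Complex.exp w)) * Complex.exp (AA Δ b w)

noncomputable def Hg (x : ℝ) (w : ℂ) : ℂ :=
  Complex.exp (-(Complex.I * x * Complex.exp w)) * Complex.exp (-Complex.exp (2 * w))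

noncomputable def Hb (Δ b x : ℝ) (w : ℂ) : ℂ :=
  Complex.exp (-(Complex.I * x * Complex.exp w)) *
    (Complex.I * (Complex.exp w - Complex.exp ((2 - Δ) * w)) * Complex.exp (AA Δ b w))

lemma tauP_bounds {Δ : ℝ} (h0 : 0 < Δ) (h1 : Δ ≤ 1/8) : 0 < tauP Δ ∧ tauP Δ ≤ 2 * Δ ∧ tauP Δ ≤ 1/4 := by
  have hpi := Real.pi_gt_three
  have hpi2 := Real.pi_lt_d2
  have hy0 : 0 < Real.pi * Δ / 2 := by positivity
  have hyb : Real.pi * Δ / 2 ≤ 1.575 * Δ := by nlinarith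
  have hy1 : Real.pi * Δ / 2 < Real.pi / 2 := by nlinarith
  have h2 : tauP Δ ≤ 2 * Δ := by
    unfold tauP
    rw [Real.tan_eq_sin_div_cos]
    have hc := Real.one_sub_sq_div_two_le_cos (x := Real.pi * Δ / 2)
    have hs := Real.sin_le hy0.le
    have hc2 : (0.97:ℝ) ≤ Real.cos (Real.pi * Δ / 2) := by nlinarith
    rw [div_le_iff₀ (by linarith)]
    nlinarith
  exact ⟨Real.tan_pos_of_pos_of_lt_pi_div_two hy0 hy1, h2, by linarith⟩

lemma tan_alpha (Δ : ℝ) : Real.tan (Real.pi * (2 - Δ) / 2) = - tauP Δ := by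
  unfold tauP
  rw [show Real.pi * (2 - Δ) / 2 = Real.pi - Real.pi * Δ / 2 by ring, Real.tan_pi_sub]

lemma cexp_mul_log {t : ℝ} (ht : 0 < t) (a : ℝ) :
    Complex.exp ((a:ℂ) * (Real.log t : ℂ)) = ((t ^ a : ℝ) : ℂ) := by
  rw [Real.rpow_def_of_pos ht]; push_cast; rw [mul_comm]

lemma cexp_log {t : ℝ} (ht : 0 < t) : Complex.exp ((Real.log t : ℂ)) = (t : ℂ) := by
  rw [← Complex.ofReal_exp, Real.exp_log ht]

lemma stableDensity_eq (Δ b x : ℝ) : stableDensity (2 - Δ) b x =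
    (1 / Real.pi) * (∫ t in Ioi (0:ℝ), Hf Δ b x (Real.log t)).re := by
  unfold stableDensity
  congr 2
  refine setIntegral_congr_fun measurableSet_Ioi (fun t ht => ?_)
  have ht : 0 < t := ht
  have h1 : Complex.exp ((2 - (Δ:ℂ)) * (Real.log t : ℂ)) = ((t ^ (2 - Δ) : ℝ) : ℂ) := by
    rw [← cexp_mul_log ht]; push_cast; rfl
  have h2 : ((t ^ (2 - Δ) : ℝ) : ℂ) * ((t ^ (1 - (2 - Δ)) : ℝ) : ℂ) = t := by
    rw [← Complex.ofReal_mul, ← Real.rpow_add ht]; simp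
  simp only [Hf, AA, h1, cexp_log ht]
  rw [tan_alpha]
  congr 2
  · ring
  · push_cast
    linear_combination (Complex.I * b * tauP Δ) * h2

lemma AA_re (Δ b s φ : ℝ) : (AA Δ b (s - φ * Complex.I)).re =
    -Real.exp ((2 - Δ) * s) * (Real.cos ((2 - Δ) * φ) + b * tauP Δ * Real.sin ((2 - Δ) * φ))
      + b * tauP Δ * Real.exp s * Real.sin φ := by
  have h1 : (2 - (Δ:ℂ)) * (s - φ * Complex.I) = (((2 - Δ) * s : ℝ) : ℂ) + ((-((2 - Δ) * φ) : ℝ) : ℂ) * Complex.I := by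
    push_cast; ring
  have h2 : ((s:ℂ) - φ * Complex.I) = (s : ℂ) + ((-φ : ℝ) : ℂ) * Complex.I := by
    push_cast; ring
  unfold AA
  rw [h1, h2, Complex.exp_add_mul_I, Complex.exp_add_mul_I, ← Complex.ofReal_exp, ← Complex.ofReal_exp,
    ← Complex.ofReal_cos, ← Complex.ofReal_cos, ← Complex.ofReal_sin, ← Complex.ofReal_sin]
  simp [-Complex.ofReal_exp, -Complex.ofReal_cos, -Complex.ofReal_sin]
  ring

lemma AA_re_le {Δ b s φ : ℝ} (h0 : 0 < Δ) (h1 : Δ ≤ 1/8) (hb : |b| ≤ 1) (hp : 0 ≤ φ) (hp2 : φ ≤ Real.pi / 6) :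
    (AA Δ b (s - φ * Complex.I)).re ≤ -Real.exp ((2 - Δ) * s) / 4 + Real.exp s / 8 := by
  rw [AA_re]
  obtain ⟨t0, t1, t2⟩ := tauP_bounds h0 h1
  have hpi := Real.pi_pos
  have hc : 1/2 ≤ Real.cos ((2 - Δ) * φ) := by
    rw [← Real.cos_pi_div_three]
    apply Real.cos_le_cos_of_nonneg_of_le_pi
    · nlinarith
    · linarith
    · nlinarith
  have hbt : |b * tauP Δ| ≤ 1/4 := by
    rw [abs_mul, abs_of_pos t0]; nlinarith [abs_nonneg b]
  have hs : |Real.sin ((2 - Δ) * φ)| ≤ 1 := Real.abs_sin_le_one _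
  have h3 : -(1/4) ≤ b * tauP Δ * Real.sin ((2 - Δ) * φ) := by
    have : |b * tauP Δ * Real.sin ((2 - Δ) * φ)| ≤ 1/4 := by
      rw [abs_mul]; nlinarith [abs_nonneg (b * tauP Δ), abs_nonneg (Real.sin ((2 - Δ) * φ))]
    exact (abs_le.1 this).1
  have hs2 : Real.sin φ ≤ 1/2 := by
    rw [← Real.sin_pi_div_six]
    apply Real.sin_le_sin_of_le_of_le_pi_div_two <;> linarith
  have hs3 : 0 ≤ Real.sin φ := Real.sin_nonneg_of_nonneg_of_le_pi hp (by linarith)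
  have h4 : b * tauP Δ * Real.sin φ ≤ 1/8 := by
    have := (abs_le.1 hbt).2
    nlinarith
  have e1 := Real.exp_pos ((2 - Δ) * s)
  have e2 := Real.exp_pos s
  nlinarith

lemma poly_decay {Δ s : ℝ} (h0 : 0 < Δ) (h1 : Δ ≤ 1/8) :
    -Real.exp ((2 - Δ) * s) / 4 + Real.exp s / 8 ≤ 101 - 3 * Real.exp s := by
  have h2 : Real.exp (s/2) ^ 3 - 1 ≤ Real.exp ((2 - Δ) * s) := by
    rw [← Real.exp_nat_mul]
    rcases le_total 0 s with hs | hs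
    · have : Real.exp (((3:ℕ):ℝ) * (s/2)) ≤ Real.exp ((2 - Δ) * s) := by
        apply Real.exp_le_exp.2; push_cast; nlinarith
      linarith
    · have : Real.exp (((3:ℕ):ℝ) * (s/2)) ≤ 1 := by
        apply Real.exp_le_one_iff.2; push_cast; linarith
      linarith [Real.exp_pos ((2 - Δ) * s)]
  have h3 : Real.exp s = Real.exp (s/2) ^ 2 := by
    rw [← Real.exp_nat_mul]; congr 1; push_cast; ring
  rw [h3]
  have hq := Real.exp_pos (s/2)
  set q := Real.exp (s/2)
  nlinarith [mul_nonneg hq.le (sq_nonneg (q - 8)), sq_nonneg (q - 8)]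

lemma norm_expx (x s φ : ℝ) :
    ‖Complex.exp (-(Complex.I * x * Complex.exp (s - φ * Complex.I)))‖ = Real.exp (- x * Real.exp s * Real.sin φ) := by
  have h2 : ((s:ℂ) - φ * Complex.I) = (s : ℂ) + ((-φ : ℝ) : ℂ) * Complex.I := by
    push_cast; ring
  rw [Complex.norm_exp, h2, Complex.exp_add_mul_I, ← Complex.ofReal_exp,
    ← Complex.ofReal_cos, ← Complex.ofReal_sin]
  simp [-Complex.ofReal_exp, -Complex.ofReal_cos, -Complex.ofReal_sin]
  ring

lemma norm_expx_le {x s φ : ℝ} (hx : 0 ≤ x) (hp : 0 ≤ φ) (hp2 : φ ≤ Real.pi / 6) :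
    ‖Complex.exp (-(Complex.I * x * Complex.exp (s - φ * Complex.I)))‖ ≤ 1 := by
  have hpi := Real.pi_pos
  rw [norm_expx, Real.exp_le_one_iff]
  have hs3 : 0 ≤ Real.sin φ := Real.sin_nonneg_of_nonneg_of_le_pi hp (by linarith)
  have : 0 ≤ x * Real.exp s * Real.sin φ := by positivity
  linarith

lemma norm_expx_real (x t : ℝ) :
    ‖Complex.exp (-(Complex.I * x * Complex.exp (t : ℂ)))‖ = 1 := by
  rw [Complex.norm_exp, ← Complex.ofReal_exp]
  simp [-Complex.ofReal_exp]

lemma norm_expAA {Δ b s φ : ℝ} (h0 : 0 < Δ) (h1 : Δ ≤ 1/8) (hb : |b| ≤ 1) (hp : 0 ≤ φ) (hp2 : φ ≤ Real.pi / 6) :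
    ‖Complex.exp (AA Δ b (s - φ * Complex.I))‖ ≤ Real.exp 101 * Real.exp (-3 * Real.exp s) := by
  rw [Complex.norm_exp, ← Real.exp_add]
  apply Real.exp_le_exp.2
  have := AA_re_le (s := s) h0 h1 hb hp hp2
  have := poly_decay (s := s) h0 h1
  linarith

lemma norm_cexp_mul (a s φ : ℝ) : ‖Complex.exp ((a:ℂ) * (s - φ * Complex.I))‖ = Real.exp (a * s) := by
  rw [Complex.norm_exp]; simp

lemma norm_cexp_mul2 (Δ s φ : ℝ) : ‖Complex.exp ((2 - (Δ:ℂ)) * (s - φ * Complex.I))‖ = Real.exp ((2 - Δ) * s) := by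
  rw [Complex.norm_exp]; simp

lemma norm_cexp_mul1 (s φ : ℝ) : ‖Complex.exp ((s - φ * Complex.I))‖ = Real.exp (s) := by
  rw [Complex.norm_exp]; simp

lemma exp_alpha_le {Δ s : ℝ} (h0 : 0 < Δ) (h1 : Δ ≤ 1/8) : Real.exp ((2 - Δ) * s) ≤ 1 + Real.exp s ^ 2 := by
  rw [← Real.exp_nat_mul]
  rcases le_total 0 s with hs | hs
  · have : Real.exp ((2 - Δ) * s) ≤ Real.exp (((2:ℕ):ℝ) * s) := by
      apply Real.exp_le_exp.2; push_cast; nlinarith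
    linarith
  · have : Real.exp ((2 - Δ) * s) ≤ 1 := by
      apply Real.exp_le_one_iff.2; nlinarith
    linarith [Real.exp_pos (((2:ℕ):ℝ) * s)]

lemma norm_diff_le {Δ s φ : ℝ} (h0 : 0 < Δ) (h1 : Δ ≤ 1/8) :
    ‖Complex.I * (Complex.exp (s - φ * Complex.I) - Complex.exp ((2 - Δ) * (s - φ * Complex.I)))‖
      ≤ 6 * Real.exp (2 * Real.exp s) := by
  rw [norm_mul, Complex.norm_I, one_mul]
  refine (norm_sub_le _ _).trans ?_
  rw [norm_cexp_mul2, norm_cexp_mul1]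
  have h2 := exp_alpha_le (s := s) h0 h1
  have hr := Real.exp_pos s
  have h3 : Real.exp (2 * Real.exp s) = Real.exp (Real.exp s) ^ 2 := by
    rw [← Real.exp_nat_mul]; push_cast; rfl
  have h4 := Real.add_one_le_exp (Real.exp s)
  rw [h3]
  nlinarith

/-- The universal constant of the majorants. -/
noncomputable def KK : ℝ := 6 * Real.exp 101

lemma KK_pos : 0 < KK := by unfold KK; positivity

lemma Hf_bound {Δ b x s φ : ℝ} (h0 : 0 < Δ) (h1 : Δ ≤ 1/8) (hb : |b| ≤ 1) (hx : 0 ≤ x)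
    (hp : 0 ≤ φ) (hp2 : φ ≤ Real.pi / 6) :
    ‖Hf Δ b x (s - φ * Complex.I)‖ ≤ KK * Real.exp (-1 * Real.exp s) := by
  unfold Hf KK
  rw [norm_mul]
  have e1 := norm_expx_le (s := s) hx hp hp2
  have e2 := norm_expAA (s := s) h0 h1 hb hp hp2
  have e3 : Real.exp (-3 * Real.exp s) ≤ Real.exp (-1 * Real.exp s) :=
    Real.exp_le_exp.2 (by nlinarith [Real.exp_pos s])
  calc _ ≤ 1 * (Real.exp 101 * Real.exp (-3 * Real.exp s)) := by gcongr
    _ ≤ _ := by nlinarith [Real.exp_pos 101, Real.exp_pos (-1 * Real.exp s)]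

lemma Hb_aux {Δ b s φ : ℝ} (h0 : 0 < Δ) (h1 : Δ ≤ 1/8) (hb : |b| ≤ 1)
    (hp : 0 ≤ φ) (hp2 : φ ≤ Real.pi / 6) :
    ‖Complex.I * (Complex.exp (s - φ * Complex.I) - Complex.exp ((2 - Δ) * (s - φ * Complex.I)))
      * Complex.exp (AA Δ b (s - φ * Complex.I))‖ ≤ KK * Real.exp (-1 * Real.exp s) := by
  unfold KK
  rw [norm_mul]
  have e2 := norm_expAA (s := s) h0 h1 hb hp hp2
  have e4 := norm_diff_le (s := s) (φ := φ) h0 h1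
  calc _ ≤ (6 * Real.exp (2 * Real.exp s)) * (Real.exp 101 * Real.exp (-3 * Real.exp s)) := by gcongr
    _ = 6 * Real.exp 101 * (Real.exp (2 * Real.exp s) * Real.exp (-3 * Real.exp s)) := by ring
    _ = _ := by rw [← Real.exp_add]; congr 2; ring

lemma Hb_bound {Δ b x s φ : ℝ} (h0 : 0 < Δ) (h1 : Δ ≤ 1/8) (hb : |b| ≤ 1) (hx : 0 ≤ x)
    (hp : 0 ≤ φ) (hp2 : φ ≤ Real.pi / 6) :
    ‖Hb Δ b x (s - φ * Complex.I)‖ ≤ KK * Real.exp (-1 * Real.exp s) := by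
  unfold Hb
  rw [norm_mul]
  have e1 := norm_expx_le (s := s) hx hp hp2
  have e2 := Hb_aux (s := s) h0 h1 hb hp hp2
  calc _ ≤ 1 * (KK * Real.exp (-1 * Real.exp s)) := by gcongr
    _ = _ := one_mul _

lemma Hg_bound {x s φ : ℝ} (hx : 0 ≤ x) (hp : 0 ≤ φ) (hp2 : φ ≤ Real.pi / 6) :
    ‖Hg x (s - φ * Complex.I)‖ ≤ KK * Real.exp (-1 * Real.exp s) := by
  unfold Hg
  rw [norm_mul]
  have e1 := norm_expx_le (s := s) hx hp hp2
  have hpi := Real.pi_pos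
  have e2 : ‖Complex.exp (-Complex.exp (2 * (s - φ * Complex.I)))‖ ≤ KK * Real.exp (-1 * Real.exp s) := by
    have h1 : 2 * ((s:ℂ) - φ * Complex.I) = ((2 * s : ℝ) : ℂ) + ((-(2 * φ) : ℝ) : ℂ) * Complex.I := by
      push_cast; ring
    rw [Complex.norm_exp, h1, Complex.exp_add_mul_I, ← Complex.ofReal_exp,
      ← Complex.ofReal_cos, ← Complex.ofReal_sin]
    simp [-Complex.ofReal_exp, -Complex.ofReal_cos, -Complex.ofReal_sin]
    have hc : 1/2 ≤ Real.cos (2 * φ) := by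
      rw [← Real.cos_pi_div_three]
      apply Real.cos_le_cos_of_nonneg_of_le_pi
      · linarith
      · linarith
      · linarith
    unfold KK
    calc Real.exp (-(Real.exp (2*s) * Real.cos (2*φ))) ≤ Real.exp (101 + -Real.exp s) := by
          apply Real.exp_le_exp.2
          have h3 : Real.exp (2*s) = Real.exp s ^ 2 := by
            rw [← Real.exp_nat_mul]; push_cast; rfl
          rw [h3]
          nlinarith [sq_nonneg (Real.exp s - 1)]
      _ = Real.exp 101 * Real.exp (-Real.exp s) := Real.exp_add _ _
      _ ≤ _ := by nlinarith [mul_pos (Real.exp_pos 101) (Real.exp_pos (-Real.exp s))]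
  calc _ ≤ 1 * (KK * Real.exp (-1 * Real.exp s)) := by gcongr
    _ = _ := one_mul _

lemma log_as (t : ℝ) : ((Real.log t : ℝ) : ℂ) = (Real.log t : ℂ) - ((0:ℝ) : ℂ) * Complex.I := by simp

lemma expAA_real {Δ b t : ℝ} (h0 : 0 < Δ) (h1 : Δ ≤ 1/8) (hb : |b| ≤ 1) (ht : 0 < t) :
    ‖Complex.exp (AA Δ b (Real.log t))‖ ≤ KK * Real.exp (-t) := by
  have := Hf_bound (x := 0) (s := Real.log t) (φ := 0) h0 h1 hb le_rfl le_rfl (by positivity)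
  rw [Real.exp_log ht] at this
  simpa [Hf] using this

lemma Hf_real {Δ b x t : ℝ} (h0 : 0 < Δ) (h1 : Δ ≤ 1/8) (hb : |b| ≤ 1) (ht : 0 < t) :
    ‖Hf Δ b x (Real.log t)‖ ≤ KK * Real.exp (-t) := by
  unfold Hf
  rw [norm_mul, norm_expx_real, one_mul]
  exact expAA_real h0 h1 hb ht

lemma Hb_real {Δ b x t : ℝ} (h0 : 0 < Δ) (h1 : Δ ≤ 1/8) (hb : |b| ≤ 1) (ht : 0 < t) :
    ‖Hb Δ b x (Real.log t)‖ ≤ KK * Real.exp (-t) := by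
  have := Hb_aux (s := Real.log t) (φ := 0) h0 h1 hb le_rfl (by positivity)
  rw [Real.exp_log ht] at this
  unfold Hb
  rw [norm_mul, norm_expx_real, one_mul]
  simpa using this

lemma expG_real {t : ℝ} (ht : 0 < t) :
    ‖Complex.exp (-Complex.exp (2 * (Real.log t : ℂ)))‖ ≤ KK * Real.exp (-t) := by
  have := Hg_bound (x := 0) (s := Real.log t) (φ := 0) le_rfl le_rfl (by positivity)
  rw [Real.exp_log ht] at this
  simpa [Hg] using this

lemma Hg_real {x t : ℝ} (ht : 0 < t) :
    ‖Hg x (Real.log t)‖ ≤ KK * Real.exp (-t) := by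
  unfold Hg
  rw [norm_mul, norm_expx_real, one_mul]
  exact expG_real ht

lemma KK_int : IntegrableOn (fun t : ℝ => KK * Real.exp (-t)) (Ioi 0) := by
  have := (exp_neg_integrableOn_Ioi 0 one_pos).const_mul KK
  simpa [IntegrableOn] using this

lemma AA_diff (Δ b : ℝ) : Differentiable ℂ (AA Δ b) := by unfold AA; fun_prop
lemma Hf_diff (Δ b x : ℝ) : Differentiable ℂ (Hf Δ b x) := by
  have := AA_diff Δ b
  unfold Hf; fun_prop
lemma Hb_diff (Δ b x : ℝ) : Differentiable ℂ (Hb Δ b x) := by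
  have := AA_diff Δ b
  unfold Hb; fun_prop
lemma Hg_diff (x : ℝ) : Differentiable ℂ (Hg x) := by
  unfold Hg; fun_prop

lemma meas_log {H : ℂ → ℂ} (hH : Differentiable ℂ H) : Measurable (fun t : ℝ => H (Real.log t)) :=
  hH.continuous.measurable.comp (Complex.measurable_ofReal.comp Real.measurable_log)

lemma int_of_bound {H : ℂ → ℂ} (hH : Differentiable ℂ H)
    (hb : ∀ t : ℝ, 0 < t → ‖H (Real.log t)‖ ≤ KK * Real.exp (-t)) :
    IntegrableOn (fun t : ℝ => H (Real.log t)) (Ioi 0) :=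
  KK_int.mono' (meas_log hH).aestronglyMeasurable
    ((ae_restrict_iff' measurableSet_Ioi).2 (Eventually.of_forall (fun t ht => hb t ht)))

lemma hasDeriv_Hf (Δ x b : ℝ) (w : ℂ) : HasDerivAt (fun b : ℝ => Hf Δ b x w) (tauP Δ * Hb Δ b x w) b := by
  have h1 : HasDerivAt (fun b : ℝ => AA Δ b w)
      (Complex.I * tauP Δ * (Complex.exp w - Complex.exp ((2 - Δ) * w))) b := by
    have h2 : HasDerivAt (fun b : ℝ => (b:ℂ)) 1 b := Complex.ofRealCLM.hasDerivAt
    have h3 := (h2.mul_const (Complex.I * tauP Δ * (Complex.exp w - Complex.exp ((2 - Δ) * w)))).add_const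
      (-Complex.exp ((2 - Δ) * w))
    rw [one_mul] at h3
    refine h3.congr_of_eventuallyEq (Eventually.of_forall fun y => ?_)
    simp only [AA]; ring
  have h4 := (h1.cexp).const_mul (Complex.exp (-(Complex.I * x * Complex.exp w)))
  unfold Hf Hb
  refine h4.congr_deriv ?_
  ring

lemma hasDeriv_stable {Δ b : ℝ} (h0 : 0 < Δ) (h1 : Δ ≤ 1/8) (hb : |b| < 1) (x : ℝ) :
    HasDerivAt (fun b => stableDensity (2 - Δ) b x)
      ((1 / Real.pi) * (tauP Δ * (∫ t in Ioi (0:ℝ), Hb Δ b x (Real.log t)).re)) b := by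
  obtain ⟨t0, t1, t2⟩ := tauP_bounds h0 h1
  have hs : Ioo (-1:ℝ) 1 ∈ 𝓝 b := by
    rw [abs_lt] at hb; exact Ioo_mem_nhds hb.1 hb.2
  have h := (hasDerivAt_integral_of_dominated_loc_of_deriv_le (μ := volume.restrict (Ioi (0:ℝ)))
    (F := fun b t => Hf Δ b x (Real.log t)) (F' := fun b t => tauP Δ * Hb Δ b x (Real.log t))
    (x₀ := b) (bound := fun t => KK * Real.exp (-t)) hs
    (Eventually.of_forall fun b => (meas_log (Hf_diff Δ b x)).aestronglyMeasurable)
    (int_of_bound (Hf_diff Δ b x) (fun t ht => Hf_real h0 h1 hb.le ht))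
    ((meas_log (Hb_diff Δ b x)).const_mul _).aestronglyMeasurable
    ((ae_restrict_iff' measurableSet_Ioi).2 (Eventually.of_forall (fun t ht b' hb' => by
      have := Hb_real (x := x) h0 h1 (abs_le.2 ⟨hb'.1.le, hb'.2.le⟩) ht
      rw [norm_mul, Complex.norm_real, Real.norm_of_nonneg t0.le]
      nlinarith [norm_nonneg (Hb Δ b' x (Real.log t))]))) KK_int
    (Eventually.of_forall (fun t b' _ => hasDeriv_Hf Δ x b' _))).2
  rw [integral_const_mul] at h
  have h2 := (Complex.reCLM.hasFDerivAt.comp_hasDerivAt b h).const_mul (1 / Real.pi)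
  simp only [Complex.reCLM_apply, Complex.re_ofReal_mul] at h2
  refine h2.congr_of_eventuallyEq (Eventually.of_forall fun y => ?_)
  simp only [stableDensity_eq]; rfl

lemma fBeta_eq {Δ b : ℝ} (h0 : 0 < Δ) (h1 : Δ ≤ 1/8) (hb : |b| < 1) (x : ℝ) :
    fBeta (2 - Δ) b x = (1 / Real.pi) * (tauP Δ * (∫ t in Ioi (0:ℝ), Hb Δ b x (Real.log t)).re) :=
  (hasDeriv_stable h0 h1 hb x).deriv

lemma AA_conj (Δ b t : ℝ) : AA Δ b t = starRingEnd ℂ (AA Δ (-b) t) := by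
  unfold AA
  simp [← Complex.exp_conj]
  left
  rw [map_ofNat]

lemma stable_neg (Δ b x : ℝ) : stableDensity (2 - Δ) b (-x) = stableDensity (2 - Δ) (-b) x := by
  rw [stableDensity_eq, stableDensity_eq]
  have : ∀ t : ℝ, Hf Δ b (-x) (Real.log t) = starRingEnd ℂ (Hf Δ (-b) x (Real.log t)) := by
    intro t
    unfold Hf
    rw [map_mul, ← Complex.exp_conj, ← Complex.exp_conj, ← AA_conj]
    simp [← Complex.exp_conj]
  simp_rw [this]
  rw [integral_conj, Complex.conj_re]

lemma fBeta_neg (Δ b x : ℝ) : fBeta (2 - Δ) b (-x) = - fBeta (2 - Δ) (-b) x := by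
  unfold fBeta
  simp_rw [stable_neg]
  exact deriv_comp_neg (fun b => stableDensity (2 - Δ) b x) b

lemma normal_eq (x : ℝ) : normalDensity x = (1 / Real.pi) * (∫ t in Ioi (0:ℝ), Hg x (Real.log t)).re := by
  have h1 : ∀ t ∈ Ioi (0:ℝ), Hg x (Real.log t) = Complex.exp (Complex.I * (-x:ℝ) * t) * Complex.exp (-1 * (t:ℂ)^2) := by
    intro t ht
    have ht : 0 < t := ht
    unfold Hg
    have : Complex.exp (2 * (Real.log t : ℂ)) = (t:ℂ)^2 := by
      rw [two_mul, Complex.exp_add, cexp_log ht, sq]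
    rw [this, cexp_log ht]
    congr 2
    · push_cast; ring
    · ring
  rw [setIntegral_congr_fun measurableSet_Ioi h1]
  set F : ℝ → ℂ := fun t => Complex.exp (Complex.I * (-x:ℝ) * t) * Complex.exp (-1 * (t:ℂ)^2) with hF
  have hFint : Integrable F := by
    have := integrable_cexp_quadratic (b := 1) (by simp) (Complex.I * (-x:ℝ)) 0
    refine this.congr (Eventually.of_forall fun t => ?_)
    simp only [hF]; rw [← Complex.exp_add]; congr 1; ring
  have hfull := fourierIntegral_gaussian (b := 1) (by simp) ((-x : ℝ) : ℂ)
  have hconj : ∀ t : ℝ, F (-t) = starRingEnd ℂ (F t) := by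
    intro t
    simp only [hF, map_mul, ← Complex.exp_conj]
    simp
  have hsplit : ∫ t, F t = (∫ t in Iic (0:ℝ), F t) + ∫ t in Ioi (0:ℝ), F t := by
    rw [← setIntegral_union (by simp) measurableSet_Ioi hFint.integrableOn hFint.integrableOn]
    simp
  have hI : ∫ t in Iic (0:ℝ), F t = starRingEnd ℂ (∫ t in Ioi (0:ℝ), F t) := by
    rw [← integral_conj]
    simp_rw [← hconj]
    rw [integral_comp_neg_Ioi]; simp
  have hre := congrArg Complex.re hsplit
  rw [hI, Complex.add_re, Complex.conj_re] at hre
  have hval : (∫ t, F t) = ((Real.sqrt Real.pi * Real.exp (-x^2/4) : ℝ) : ℂ) := by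
    rw [hfull]
    rw [div_one, ← Complex.ofReal_one, ← Complex.ofReal_ofNat, ← Complex.ofReal_div, ← Complex.ofReal_cpow Real.pi_pos.le,
      ← Real.sqrt_eq_rpow]
    push_cast
    simp
  rw [hval, Complex.ofReal_re] at hre
  unfold normalDensity
  have : (∫ t in Ioi (0:ℝ), F t).re = (Real.sqrt Real.pi * Real.exp (-x^2/4)) / 2 := by linarith
  rw [this]
  have hs := Real.sq_sqrt Real.pi_pos.le
  have hs0 := Real.sqrt_pos.2 Real.pi_pos
  nth_rewrite 2 [← hs]
  field_simp

lemma cont_Hf {Δ b : ℝ} (h0 : 0 < Δ) (h1 : Δ ≤ 1/8) (hb : |b| ≤ 1) :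
    Continuous (fun x => stableDensity (2 - Δ) b x) := by
  simp_rw [stableDensity_eq]
  refine continuous_const.mul (Complex.continuous_re.comp ?_)
  refine continuous_of_dominated (fun x => (meas_log (Hf_diff Δ b x)).aestronglyMeasurable)
    (bound := fun t => KK * Real.exp (-t)) (fun x => ?_) KK_int ?_
  · exact (ae_restrict_iff' measurableSet_Ioi).2 (Eventually.of_forall (fun t ht => Hf_real h0 h1 hb ht))
  · refine Eventually.of_forall (fun t => ?_)
    unfold Hf; fun_prop

lemma cont_Hb {Δ b : ℝ} (h0 : 0 < Δ) (h1 : Δ ≤ 1/8) (hb : |b| < 1) :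
    Continuous (fun x => fBeta (2 - Δ) b x) := by
  simp_rw [fBeta_eq h0 h1 hb]
  refine continuous_const.mul (continuous_const.mul (Complex.continuous_re.comp ?_))
  refine continuous_of_dominated (fun x => (meas_log (Hb_diff Δ b x)).aestronglyMeasurable)
    (bound := fun t => KK * Real.exp (-t)) (fun x => ?_) KK_int ?_
  · exact (ae_restrict_iff' measurableSet_Ioi).2 (Eventually.of_forall (fun t ht => Hb_real h0 h1 hb.le ht))
  · refine Eventually.of_forall (fun t => ?_)
    unfold Hb; fun_prop

lemma fBeta_le {Δ b : ℝ} (h0 : 0 < Δ) (h1 : Δ ≤ 1/8) (hb : |b| < 1) (x : ℝ) :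
    |fBeta (2 - Δ) b x| ≤ KK * Δ := by
  obtain ⟨t0, t1, t2⟩ := tauP_bounds h0 h1
  rw [fBeta_eq h0 h1 hb]
  have hn : ‖∫ t in Ioi (0:ℝ), Hb Δ b x (Real.log t)‖ ≤ KK := by
    have := norm_integral_le_of_norm_le KK_int
      ((ae_restrict_iff' measurableSet_Ioi).2 (Eventually.of_forall
        (fun t ht => Hb_real (x := x) h0 h1 hb.le ht)))
    rwa [integral_const_mul, integral_exp_neg_Ioi_zero, mul_one] at this
  have hr := (Complex.abs_re_le_norm _).trans hn
  rw [abs_mul, abs_mul, abs_of_pos t0, abs_of_pos (by positivity)]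
  have hpi : 1 / Real.pi ≤ 1/2 := by
    apply one_div_le_one_div_of_le <;> linarith [Real.pi_gt_three]
  calc _ ≤ 1/2 * (2 * Δ * KK) := by gcongr
    _ = _ := by ring

noncomputable def etaP (b Δ : ℝ) : ℝ :=
  ∫ t in Ioi (0:ℝ), ‖Complex.exp (AA Δ b (Real.log t)) - Complex.exp (-Complex.exp (2 * (Real.log t : ℂ)))‖

lemma eta_tendsto {b : ℝ} (hb : |b| ≤ 1) : Tendsto (etaP b) (𝓝[>] 0) (𝓝 0) := by
  suffices hh : Tendsto (etaP b) (𝓝[>] 0) (𝓝 (∫ t in Ioi (0:ℝ), (0:ℝ))) by simpa using hh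
  have hev : ∀ᶠ Δ : ℝ in 𝓝[>] (0:ℝ), 0 < Δ ∧ Δ ≤ 1/8 := by
    filter_upwards [Ioc_mem_nhdsGT (show (0:ℝ) < 1/8 by norm_num)] with Δ h using h
  refine tendsto_integral_filter_of_dominated_convergence (fun t => 2 * (KK * Real.exp (-t))) ?_ ?_
    (KK_int.const_mul 2) ?_
  · refine Eventually.of_forall fun Δ => ?_
    have := AA_diff Δ b
    exact (meas_log (H := fun w => Complex.exp (AA Δ b w) - Complex.exp (-Complex.exp (2 * w)))
      (by fun_prop)).norm.aestronglyMeasurable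
  · filter_upwards [hev] with Δ h
    refine (ae_restrict_iff' measurableSet_Ioi).2 (Eventually.of_forall (fun t ht => ?_))
    rw [norm_norm]
    refine (norm_sub_le _ _).trans ?_
    linarith [expAA_real h.1 h.2 hb ht, expG_real ht]
  · refine Eventually.of_forall fun t => ?_
    have htau : Tendsto tauP (𝓝[>] 0) (𝓝 0) := by
      have : ContinuousAt tauP 0 := by
        unfold tauP
        have : ContinuousAt Real.tan (Real.pi * 0 / 2) := by
          rw [Real.continuousAt_tan]; simp
        exact ContinuousAt.comp (f := fun Δ : ℝ => Real.pi * Δ / 2) this (by fun_prop)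
      have h := this.tendsto
      simp only [tauP, mul_zero, zero_div, Real.tan_zero] at h
      exact h.mono_left nhdsWithin_le_nhds
    have hid : Tendsto (fun Δ : ℝ => Δ) (𝓝[>] 0) (𝓝 0) := tendsto_id.mono_left nhdsWithin_le_nhds
    have hpair := htau.prodMk_nhds hid
    have hc : Continuous (fun q : ℝ × ℝ => ‖Complex.exp (-(1 + Complex.I * b * q.1) * Complex.exp ((2 - q.2) * (Real.log t : ℂ)) + Complex.I * b * q.1 * Complex.exp (Real.log t : ℂ)) - Complex.exp (-Complex.exp (2 * (Real.log t : ℂ)))‖) := by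
      fun_prop
    have h := (hc.tendsto (0,0)).comp hpair
    simpa [Function.comp_def, AA] using h

lemma stable_sub_normal {Δ b : ℝ} (h0 : 0 < Δ) (h1 : Δ ≤ 1/8) (hb : |b| ≤ 1) (x : ℝ) :
    stableDensity (2 - Δ) b x - normalDensity x =
      (1 / Real.pi) * (∫ t in Ioi (0:ℝ), (Hf Δ b x (Real.log t) - Hg x (Real.log t))).re := by
  rw [stableDensity_eq, normal_eq, integral_sub
    (int_of_bound (Hf_diff Δ b x) (fun t ht => Hf_real h0 h1 hb ht))
    (int_of_bound (Hg_diff x) (fun t ht => Hg_real ht)), Complex.sub_re]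
  ring

lemma stable_eta {Δ b : ℝ} (h0 : 0 < Δ) (h1 : Δ ≤ 1/8) (hb : |b| ≤ 1) (x : ℝ) :
    |stableDensity (2 - Δ) b x - normalDensity x| ≤ etaP b Δ := by
  rw [stable_sub_normal h0 h1 hb, abs_mul, abs_of_pos (by positivity)]
  have hn : ‖∫ t in Ioi (0:ℝ), (Hf Δ b x (Real.log t) - Hg x (Real.log t))‖ ≤ etaP b Δ := by
    refine (norm_integral_le_integral_norm _).trans_eq ?_
    unfold etaP
    congr 1; ext t
    unfold Hf Hg
    rw [← mul_sub, norm_mul, norm_expx_real, one_mul]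
  have hr := (Complex.abs_re_le_norm _).trans hn
  have hpi : 1 / Real.pi ≤ 1 := by
    rw [div_le_one Real.pi_pos]; linarith [Real.pi_gt_three]
  calc _ ≤ 1 * etaP b Δ := by gcongr
    _ = _ := one_mul _

lemma norm_exp_sub_one {s : ℂ} {m : ℝ} (hm : 0 ≤ m) (hs : s.re ≤ m) :
    ‖Complex.exp s - 1‖ ≤ Real.exp m * ‖s‖ := by
  have h := (convex_halfSpace_re_le m).norm_image_sub_le_of_norm_deriv_le (𝕜 := ℂ) (f := Complex.exp)
    (C := Real.exp m) (x := 0) (y := s) (fun x _ => Complex.differentiable_exp x) ?_ (by simpa using hm) hs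
  · simpa using h
  · intro x hx
    rw [Complex.deriv_exp, Complex.norm_exp]
    exact Real.exp_le_exp.2 hx

lemma norm_exp_diff {A B : ℂ} {m M : ℝ} (hm : 0 ≤ m) (hA : A.re ≤ m) (hB : B.re ≤ m)
    (hA' : ‖A‖ ≤ M) (hB' : ‖B‖ ≤ M) :
    ‖Complex.exp A - Complex.exp B - (A - B)‖ ≤ Real.exp m * M * ‖A - B‖ := by
  have hconv : Convex ℝ ({s : ℂ | s.re ≤ m} ∩ Metric.closedBall 0 M) :=
    (convex_halfSpace_re_le m).inter (convex_closedBall 0 M)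
  have h := hconv.norm_image_sub_le_of_norm_deriv_le (𝕜 := ℂ) (f := fun s => Complex.exp s - s)
    (C := Real.exp m * M) (x := B) (y := A) (fun x _ => by fun_prop) ?_
    ⟨hB, by simpa using hB'⟩ ⟨hA, by simpa using hA'⟩
  · have he : Complex.exp A - Complex.exp B - (A - B) = (Complex.exp A - A) - (Complex.exp B - B) := by ring
    rw [he]; exact h
  · intro x hx
    have hd : deriv (fun s => Complex.exp s - s) x = Complex.exp x - 1 :=
      ((Complex.hasDerivAt_exp x).sub (hasDerivAt_id x)).deriv
    rw [hd]
    refine (norm_exp_sub_one hm hx.1).trans ?_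
    have : ‖x‖ ≤ M := by simpa using hx.2
    gcongr

/-- the point on the ray -/
noncomputable def wP (u : ℝ) : ℂ := (Real.log u : ℂ) - ((Real.pi / 6 : ℝ) : ℂ) * Complex.I

lemma mono_bound {p x s φ : ℝ} (hp0 : 0 ≤ p) (hp2 : p ≤ 2) (hx : 0 < x)
    (h1 : Real.pi / 6 ≤ φ) (h2 : φ ≤ Real.pi / 2) :
    ‖Complex.exp (-(Complex.I * x * Complex.exp (s - φ * Complex.I))) * Complex.exp (p * (s - φ * Complex.I))‖
      ≤ (1 + 32 / x^2) * Real.exp (-(x/4) * Real.exp s) := by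
  rw [norm_mul, norm_expx, norm_cexp_mul]
  have hpi := Real.pi_pos
  have hs : 1/2 ≤ Real.sin φ := by
    rw [← Real.sin_pi_div_six]
    apply Real.sin_le_sin_of_le_of_le_pi_div_two <;> linarith
  have hr := Real.exp_pos s
  have e1 : Real.exp (-x * Real.exp s * Real.sin φ) ≤ Real.exp (-(x/2) * Real.exp s) := by
    apply Real.exp_le_exp.2
    nlinarith [mul_pos hx hr]
  have e2 : Real.exp (p * s) ≤ 1 + Real.exp s ^ 2 := by
    rw [← Real.exp_nat_mul]
    rcases le_total 0 s with hs | hs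
    · have : Real.exp (p * s) ≤ Real.exp (((2:ℕ):ℝ) * s) := by
        apply Real.exp_le_exp.2; push_cast; nlinarith
      linarith
    · have : Real.exp (p * s) ≤ 1 := by
        apply Real.exp_le_one_iff.2; nlinarith
      linarith [Real.exp_pos (((2:ℕ):ℝ) * s)]
  have e3 : 1 + Real.exp s ^ 2 ≤ (1 + 32 / x^2) * Real.exp ((x/4) * Real.exp s) := by
    have h3 := Real.pow_div_factorial_le_exp ((x/4) * Real.exp s) (by positivity) 2
    have h4 := Real.one_le_exp (show 0 ≤ (x/4) * Real.exp s by positivity)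
    have h5 : Real.exp s ^ 2 = 32 / x^2 * (((x/4) * Real.exp s)^2 / (Nat.factorial 2 : ℝ)) := by
      simp [Nat.factorial]; field_simp; ring
    rw [h5]
    have : 0 < 32 / x^2 := by positivity
    nlinarith
  calc _ ≤ Real.exp (-(x/2) * Real.exp s) * ((1 + 32 / x^2) * Real.exp ((x/4) * Real.exp s)) := by
        gcongr; exact e2.trans e3
    _ = (1 + 32 / x^2) * (Real.exp (-(x/2) * Real.exp s) * Real.exp ((x/4) * Real.exp s)) := by ring
    _ = _ := by rw [← Real.exp_add]; congr 2; ring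

noncomputable def monoP (p x u : ℝ) : ℂ :=
  Complex.exp (-(Complex.I * x * Complex.exp (wP u))) * Complex.exp (p * wP u) *
    Complex.exp (-((Real.pi/6 : ℝ) : ℂ) * Complex.I)

lemma norm_om (p : ℝ) : ‖Complex.exp (-(p : ℂ) * Complex.I)‖ = 1 := by
  rw [Complex.norm_exp]; simp

lemma meas_wP {H : ℂ → ℂ} (hH : Differentiable ℂ H) : Measurable (fun t : ℝ => H (wP t)) := by
  unfold wP
  exact meas_log (H := fun w => H (w - ((Real.pi / 6 : ℝ) : ℂ) * Complex.I)) (by fun_prop)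

lemma monoP_int {p x : ℝ} (hp0 : 0 ≤ p) (hp2 : p ≤ 2) (hx : 0 < x) :
    IntegrableOn (monoP p x) (Ioi 0) := by
  have hpi := Real.pi_pos
  refine ((exp_neg_integrableOn_Ioi 0 (show 0 < x/4 by positivity)).const_mul (1 + 32 / x^2)).mono' ?_ ?_
  · unfold monoP
    exact (meas_wP (H := fun w => Complex.exp (-(Complex.I * x * Complex.exp w)) * Complex.exp (p * w) *
      Complex.exp (-((Real.pi/6 : ℝ) : ℂ) * Complex.I)) (by fun_prop)).aestronglyMeasurable
  · refine (ae_restrict_iff' measurableSet_Ioi).2 (Eventually.of_forall (fun u hu => ?_))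
    have hu : 0 < u := hu
    have := mono_bound (s := Real.log u) (φ := Real.pi / 6) hp0 hp2 hx le_rfl (by linarith)
    rw [Real.exp_log hu] at this
    unfold monoP
    rw [norm_mul, norm_om, mul_one]
    exact this

lemma monoP_val {p x : ℝ} (hp0 : 0 ≤ p) (hp2 : p ≤ 2) (hx : 0 < x) :
    ∫ u in Ioi (0:ℝ), monoP p x u =
      ((Real.Gamma (p + 1) * x ^ (-(p + 1)) : ℝ) : ℂ) * Complex.exp (-((Real.pi / 2 * (p + 1) : ℝ) : ℂ) * Complex.I) := by
  have hpi := Real.pi_pos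
  have h := rayRot (fun w => Complex.exp (-(Complex.I * x * Complex.exp w)) * Complex.exp (p * w)) (by fun_prop)
    (Real.pi / 6) (Real.pi / 2) (x/4) (1 + 32 / x^2) (by linarith) (by positivity)
    (fun s φ h1 h2 => mono_bound hp0 hp2 hx h1 h2)
  have h' : ∫ u in Ioi (0:ℝ), monoP p x u = _ := h
  rw [h']
  have hpt : ∀ u ∈ Ioi (0:ℝ), Complex.exp (-(Complex.I * x * Complex.exp ((Real.log u : ℂ) - ((Real.pi / 2 : ℝ) : ℂ) * Complex.I))) *
      Complex.exp (p * ((Real.log u : ℂ) - ((Real.pi / 2 : ℝ) : ℂ) * Complex.I)) *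
      Complex.exp (-((Real.pi/2 : ℝ) : ℂ) * Complex.I) =
      ((u ^ ((p + 1) - 1) * Real.exp (-(x * u)) : ℝ) : ℂ) * Complex.exp (-((Real.pi / 2 * (p + 1) : ℝ) : ℂ) * Complex.I) := by
    intro u hu
    have hu : 0 < u := hu
    have e1 : Complex.exp ((Real.log u : ℂ) - ((Real.pi / 2 : ℝ) : ℂ) * Complex.I) = -(u * Complex.I) := by
      rw [Complex.exp_sub, cexp_log hu]
      push_cast
      rw [Complex.exp_pi_div_two_mul_I, Complex.div_I]
    have e2 : Complex.exp (p * ((Real.log u : ℂ) - ((Real.pi / 2 : ℝ) : ℂ) * Complex.I)) =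
        ((u ^ p : ℝ) : ℂ) * Complex.exp (-((Real.pi / 2 * p : ℝ) : ℂ) * Complex.I) := by
      rw [← cexp_mul_log hu, ← Complex.exp_add]; congr 1; push_cast; ring
    have e3 : -(Complex.I * x * -(u * Complex.I)) = ((-(x * u) : ℝ) : ℂ) := by
      push_cast; linear_combination (x * u : ℂ) * Complex.I_mul_I
    rw [e1, e2, e3, ← Complex.ofReal_exp, add_sub_cancel_right]
    have e4 : Complex.exp (-((Real.pi / 2 * (p + 1) : ℝ) : ℂ) * Complex.I) =
      Complex.exp (-((Real.pi / 2 * p : ℝ) : ℂ) * Complex.I) * Complex.exp (-((Real.pi/2 : ℝ) : ℂ) * Complex.I) := by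
      rw [← Complex.exp_add]; congr 1; push_cast; ring
    rw [e4, Complex.ofReal_mul (u ^ p)]; ring
  rw [setIntegral_congr_fun measurableSet_Ioi hpt, integral_mul_const]
  congr 1
  rw [integral_complex_ofReal, Real.integral_rpow_mul_exp_neg_mul_Ioi (by linarith) hx]
  rw [one_div, Real.inv_rpow hx.le, Real.rpow_neg hx.le, mul_comm]

lemma rpow_diff_le {u Δ : ℝ} (hu : 0 < u) (h0 : 0 < Δ) (h1 : Δ ≤ 1/8) :
    |u ^ (2 - Δ) - u ^ 2| ≤ Δ * (2 * u + u ^ 3) := by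
  rcases le_total 1 u with h | h
  · have e1 : u ^ (2 - Δ) = u ^ 2 * Real.exp (-(Δ * Real.log u)) := by
      rw [sub_eq_add_neg, Real.rpow_add hu, Real.rpow_two, Real.rpow_def_of_pos hu (-Δ)]; congr 2; ring
    have hl := Real.log_nonneg h
    have hl2 := Real.log_le_sub_one_of_pos hu
    have e2 := Real.add_one_le_exp (-(Δ * Real.log u))
    have e3 : Real.exp (-(Δ * Real.log u)) ≤ 1 := Real.exp_le_one_iff.2 (by nlinarith)
    rw [e1, abs_le]
    have hu2 : 0 < u^2 := by positivity
    constructor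
    · have : u^2 * (-(Δ * Real.log u) + 1) ≤ u^2 * Real.exp (-(Δ * Real.log u)) := by gcongr
      have h5 : u^2 * (Δ * Real.log u) ≤ u^2 * (Δ * u) := by gcongr; linarith
      nlinarith [mul_pos h0 hu]
    · have : u^2 * Real.exp (-(Δ * Real.log u)) ≤ u^2 * 1 := by gcongr
      have : 0 ≤ Δ * (2 * u + u^3) := by positivity
      linarith
  · have e1 : u ^ 2 = u ^ (2 - Δ) * Real.exp (-(Δ * -Real.log u)) := by
      rw [← Real.rpow_two, show (2:ℝ) = (2 - Δ) + Δ by ring, Real.rpow_add hu, Real.rpow_def_of_pos hu Δ]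
      congr 2
      · ring
      · ring
    have hl := Real.log_nonpos hu.le h
    have e2 := Real.add_one_le_exp (-(Δ * -Real.log u))
    have e3 : Real.exp (-(Δ * -Real.log u)) ≤ 1 := Real.exp_le_one_iff.2 (by nlinarith)
    have hup : 0 < u ^ (2 - Δ) := Real.rpow_pos_of_pos hu _
    have hu3 : u ^ (2 - Δ) ≤ u * Real.sqrt u := by
      rw [Real.sqrt_eq_rpow]
      nth_rewrite 2 [← Real.rpow_one u]
      rw [← Real.rpow_add hu]
      exact Real.rpow_le_rpow_of_exponent_ge hu h (by linarith)
    have hsq : Real.sqrt u * -Real.log u ≤ 2 := by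
      have h6 := Real.abs_log_mul_self_lt (Real.sqrt u) (Real.sqrt_pos.2 hu) (Real.sqrt_le_one.2 h)
      rw [Real.log_sqrt hu.le] at h6
      have := (abs_lt.1 h6).1
      linarith
    rw [abs_le]
    constructor
    · have h7 : u^2 ≤ u ^ (2 - Δ) := by
        calc u^2 = _ := e1
          _ ≤ u ^ (2 - Δ) * 1 := by gcongr
          _ = _ := mul_one _
      have : 0 ≤ Δ * (2 * u + u^3) := by positivity
      linarith
    · have h8 : u ^ (2 - Δ) * (-(Δ * -Real.log u) + 1) ≤ u ^ 2 := by
        rw [e1]; gcongr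
      have h9 : u ^ (2 - Δ) * (-Real.log u) ≤ u * Real.sqrt u * (-Real.log u) := by
        gcongr; linarith
      have h10 : u * Real.sqrt u * (-Real.log u) ≤ u * 2 := by
        rw [mul_assoc]; gcongr
      have : 0 < u^3 := by positivity
      nlinarith [mul_pos h0 this]

/-- constant bounding `V^5 e^{-v/8}` -/
noncomputable def K5 : ℝ := 8 ^ 5 * 120 * Real.exp (1/8)

lemma K5_pos : 0 < K5 := by unfold K5; positivity

lemma pow5_le {v : ℝ} (hv : 0 ≤ v) : (1 + v) ^ 5 * Real.exp (-v/4) ≤ K5 * Real.exp (-(v/8)) := by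
  have h3 := Real.pow_div_factorial_le_exp ((1 + v)/8) (by positivity) 5
  have h4 : (1 + v)^5 = 8^5 * 120 * (((1+v)/8)^5 / (Nat.factorial 5 : ℝ)) := by
    simp [Nat.factorial]; ring
  unfold K5
  rw [h4]
  calc _ ≤ 8^5 * 120 * Real.exp ((1+v)/8) * Real.exp (-v/4) := by gcongr
    _ = 8^5 * 120 * (Real.exp ((1+v)/8) * Real.exp (-v/4)) := by ring
    _ = 8^5 * 120 * (Real.exp (1/8) * Real.exp (-(v/8))) := by
      rw [← Real.exp_add, ← Real.exp_add]; congr 2; ring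
    _ = _ := by ring

section
variable {Δ b x u : ℝ}

lemma u_est (h0 : 0 < Δ) (h1 : Δ ≤ 1/8) (hx : 1 ≤ x) (hu : 0 < u) :
    u ≤ (1 + x*u) / x ∧ u ^ (2 - Δ) ≤ (1 + x*u)^2 * x ^ (-(2-Δ)) ∧ x ^ (-(2-Δ)) ≤ 1/x ∧
      1/x^2 ≤ x ^ (-(2-Δ)) := by
  have hx0 : 0 < x := by linarith
  refine ⟨?_, ?_, ?_, ?_⟩
  · rw [le_div_iff₀ hx0]; linarith
  · have hV : 1 ≤ 1 + x*u := by nlinarith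
    have e1 : u ^ (2-Δ) = (x*u)^(2-Δ) * x ^ (-(2-Δ)) := by
      rw [Real.mul_rpow hx0.le hu.le, Real.rpow_neg hx0.le]
      have := Real.rpow_pos_of_pos hx0 (2-Δ)
      field_simp
    rw [e1]
    have e2 : (x*u)^(2-Δ) ≤ (1+x*u)^2 := by
      calc (x*u)^(2-Δ) ≤ (1+x*u)^(2-Δ) := by
            apply Real.rpow_le_rpow (by positivity) (by linarith) (by linarith)
        _ ≤ (1+x*u)^(2:ℝ) := Real.rpow_le_rpow_of_exponent_le hV (by linarith)
        _ = _ := Real.rpow_two _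
    gcongr
  · have : x ^ (-(2-Δ)) ≤ x ^ (-1:ℝ) := Real.rpow_le_rpow_of_exponent_le hx (by linarith)
    rwa [Real.rpow_neg_one, ← one_div] at this
  · have : x ^ (-2:ℝ) ≤ x ^ (-(2-Δ)) := Real.rpow_le_rpow_of_exponent_le hx (by linarith)
    rwa [Real.rpow_neg hx0.le, Real.rpow_two, ← one_div] at this

lemma norm_P (hu : 0 < u) : ‖Complex.exp ((2 - (Δ:ℂ)) * wP u)‖ = u ^ (2 - Δ) := by
  unfold wP
  rw [norm_cexp_mul2, Real.rpow_def_of_pos hu]; congr 1; ring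

lemma norm_z (hu : 0 < u) : ‖Complex.exp (wP u)‖ = u := by
  unfold wP
  rw [norm_cexp_mul1, Real.exp_log hu]

lemma norm_z2 (hu : 0 < u) : ‖Complex.exp (2 * wP u)‖ = u^2 := by
  rw [two_mul, Complex.exp_add, norm_mul, norm_z hu]; ring

lemma norm_A (h0 : 0 < Δ) (h1 : Δ ≤ 1/8) (hb : |b| ≤ 1) (hx : 1 ≤ x) (hu : 0 < u) :
    ‖AA Δ b (wP u)‖ ≤ 2 * (1 + x*u)^2 * (x * x ^ (-(2-Δ))) * (1/x + Δ) := by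
  obtain ⟨t0, t1, t2⟩ := tauP_bounds h0 h1
  obtain ⟨e1, e2, e3, e4⟩ := u_est h0 h1 hx hu
  have hx0 : 0 < x := by linarith
  have hV : 1 ≤ 1 + x*u := by nlinarith
  have hbt : ‖Complex.I * b * tauP Δ‖ ≤ 2 * Δ ∧ ‖Complex.I * b * tauP Δ‖ ≤ 1 := by
    rw [norm_mul, norm_mul, Complex.norm_I, one_mul, Complex.norm_real, Complex.norm_real, Real.norm_eq_abs,
      Real.norm_of_nonneg t0.le]
    constructor <;> nlinarith [abs_nonneg b]
  have hA : ‖AA Δ b (wP u)‖ ≤ 2 * u ^ (2-Δ) + 2 * Δ * u := by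
    unfold AA
    refine (norm_add_le _ _).trans ?_
    rw [norm_mul, norm_mul, norm_neg, norm_P hu, norm_z hu]
    have : ‖1 + Complex.I * b * tauP Δ‖ ≤ 2 := by
      refine (norm_add_le _ _).trans ?_
      rw [norm_one]; linarith [hbt.2]
    gcongr
    exact hbt.1
  set X := x ^ (-(2-Δ)) with hX
  have hXp : 0 < X := Real.rpow_pos_of_pos hx0 _
  have h5 : u ≤ (1+x*u)^2 * (x * X) := by
    have : 1/x ≤ x * X := by
      calc 1/x = x * (1/x^2) := by field_simp
        _ ≤ _ := by gcongr
    calc u ≤ (1+x*u) * (1/x) := by rw [mul_one_div]; exact e1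
      _ ≤ (1+x*u)^2 * (x*X) := by gcongr; nlinarith
  have h6 : 2 * (1 + x*u)^2 * (x * X) * (1/x + Δ) = 2 * ((1+x*u)^2 * X) + 2 * Δ * ((1+x*u)^2 * (x*X)) := by
    field_simp
  rw [h6]
  refine hA.trans ?_
  gcongr

lemma norm_AB (h0 : 0 < Δ) (h1 : Δ ≤ 1/8) (hb : |b| ≤ 1) (hx : 1 ≤ x) (hu : 0 < u) :
    ‖AA Δ b (wP u) - -Complex.exp (2 * wP u)‖ ≤ 8 * Δ * (1 + x*u)^3 / x := by
  obtain ⟨t0, t1, t2⟩ := tauP_bounds h0 h1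
  obtain ⟨e1, e2, e3, e4⟩ := u_est h0 h1 hx hu
  have hx0 : 0 < x := by linarith
  have hV : 1 ≤ 1 + x*u := by nlinarith
  have hbt : ‖Complex.I * b * tauP Δ‖ ≤ 2 * Δ := by
    rw [norm_mul, norm_mul, Complex.norm_I, one_mul, Complex.norm_real, Complex.norm_real, Real.norm_eq_abs,
      Real.norm_of_nonneg t0.le]
    nlinarith [abs_nonneg b]
  have hz2 : Complex.exp (2 * wP u) = ((u^2 : ℝ):ℂ) * Complex.exp (-((Real.pi/3 : ℝ):ℂ) * Complex.I) := by
    unfold wP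
    rw [mul_sub, sub_eq_add_neg, Complex.exp_add, two_mul, Complex.exp_add, cexp_log hu]
    congr 1
    · push_cast; ring
    · congr 1; push_cast; ring
  have hP : Complex.exp ((2 - (Δ:ℂ)) * wP u) = ((u^(2-Δ) : ℝ):ℂ) *
      (Complex.exp (-((Real.pi/3 : ℝ):ℂ) * Complex.I) * Complex.exp (Complex.I * ((Δ * (Real.pi/6) : ℝ):ℂ))) := by
    unfold wP
    rw [← cexp_mul_log hu, ← Complex.exp_add, ← Complex.exp_add]
    congr 1; push_cast; ring
  have hd : ‖Complex.exp (2 * wP u) - Complex.exp ((2 - (Δ:ℂ)) * wP u)‖ ≤ Δ * (2*u+u^3) + Δ * u ^ (2-Δ) := by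
    have : Complex.exp (2 * wP u) - Complex.exp ((2 - (Δ:ℂ)) * wP u) =
        Complex.exp (-((Real.pi/3 : ℝ):ℂ) * Complex.I) * (((u^2 - u^(2-Δ) : ℝ) : ℂ)
          - ((u^(2-Δ) : ℝ):ℂ) * (Complex.exp (Complex.I * ((Δ * (Real.pi/6) : ℝ):ℂ)) - 1)) := by
      rw [hz2, hP, Complex.ofReal_sub]; ring
    rw [this, norm_mul, norm_om, one_mul]
    refine (norm_sub_le _ _).trans ?_
    rw [norm_mul, Complex.norm_real, Complex.norm_real, Real.norm_of_nonneg (Real.rpow_nonneg hu.le _), Real.norm_eq_abs, abs_sub_comm]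
    have h2 := rpow_diff_le hu h0 h1
    have h3 : ‖Complex.exp (Complex.I * ((Δ * (Real.pi/6) : ℝ):ℂ)) - 1‖ ≤ Δ := by
      refine (Real.norm_exp_I_mul_ofReal_sub_one_le).trans ?_
      rw [Real.norm_of_nonneg (by positivity)]
      nlinarith [Real.pi_lt_d2]
    have h4 : 0 ≤ u ^ (2-Δ) := Real.rpow_nonneg hu.le _
    nlinarith
  have hdec : AA Δ b (wP u) - -Complex.exp (2 * wP u) =
      (Complex.exp (2 * wP u) - Complex.exp ((2 - (Δ:ℂ)) * wP u)) + (Complex.I * b * tauP Δ) * (Complex.exp (wP u) - Complex.exp ((2 - (Δ:ℂ)) * wP u)) := by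
    unfold AA; ring
  have hn : ‖AA Δ b (wP u) - -Complex.exp (2 * wP u)‖ ≤ (Δ * (2*u+u^3) + Δ * u ^ (2-Δ)) + 2 * Δ * (u + u ^ (2-Δ)) := by
    rw [hdec]
    refine (norm_add_le _ _).trans ?_
    rw [norm_mul (Complex.I * b * tauP Δ)]
    have : ‖Complex.exp (wP u) - Complex.exp ((2 - (Δ:ℂ)) * wP u)‖ ≤ u + u ^ (2-Δ) := by
      refine (norm_sub_le _ _).trans ?_
      rw [norm_P hu, norm_z hu]
    gcongr
  set V := 1 + x*u with hVdef
  set X := x ^ (-(2-Δ)) with hX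
  have hXp : 0 < X := Real.rpow_pos_of_pos hx0 _
  have k1 : u ≤ V^3/x := e1.trans (by gcongr; nlinarith [sq_nonneg V])
  have k2 : u ^ (2-Δ) ≤ V^3/x := by
    calc u ^ (2-Δ) ≤ V^2 * X := e2
      _ ≤ V^3 * (1/x) := by gcongr; norm_num
      _ = _ := by ring
  have k3 : u^3 ≤ V^3/x := by
    calc u^3 ≤ (V/x)^3 := by gcongr
      _ = V^3/x^3 := by rw [div_pow]
      _ ≤ V^3/x^1 := by gcongr; norm_num
      _ = _ := by rw [pow_one]
  refine hn.trans ?_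
  have : (Δ * (2*u+u^3) + Δ * u ^ (2-Δ)) + 2 * Δ * (u + u ^ (2-Δ)) = Δ * (4 * u + u^3 + 3 * u^(2-Δ)) := by ring
  rw [this]
  calc Δ * (4 * u + u^3 + 3 * u^(2-Δ)) ≤ Δ * (4 * (V^3/x) + V^3/x + 3 * (V^3/x)) := by gcongr
    _ = _ := by ring

lemma AA_re_w (h0 : 0 < Δ) (h1 : Δ ≤ 1/8) (hb : |b| ≤ 1) (hu : 0 < u) : (AA Δ b (wP u)).re ≤ u/8 := by
  have := AA_re_le (s := Real.log u) (φ := Real.pi/6) h0 h1 hb (by positivity) le_rfl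
  rw [Real.exp_log hu] at this
  unfold wP
  linarith [Real.exp_pos ((2-Δ) * Real.log u)]

lemma B_re_w (hu : 0 < u) : (-Complex.exp (2 * wP u)).re ≤ u/8 := by
  have h1 : 2 * wP u = ((2 * Real.log u : ℝ) : ℂ) + ((-(Real.pi/3) : ℝ) : ℂ) * Complex.I := by
    unfold wP; push_cast; ring
  rw [h1, Complex.exp_add_mul_I, ← Complex.ofReal_exp, ← Complex.ofReal_cos, ← Complex.ofReal_sin]
  simp [-Complex.ofReal_exp, -Complex.ofReal_cos, -Complex.ofReal_sin]
  linarith [Real.exp_pos (2 * Real.log u)]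

lemma norm_ex_w (hu : 0 < u) : ‖Complex.exp (-(Complex.I * x * Complex.exp (wP u)))‖ = Real.exp (-(x*u)/2) := by
  unfold wP
  rw [norm_expx, Real.exp_log hu, Real.sin_pi_div_six]; congr 1; ring

lemma exp_comb (hx : 1 ≤ x) (hu : 0 < u) : Real.exp (-(x*u)/2) * Real.exp (u/8) ≤ Real.exp (-(x*u)/4) := by
  rw [← Real.exp_add]
  apply Real.exp_le_exp.2
  nlinarith [mul_nonneg (sub_nonneg.2 hx) hu.le]

lemma err_f (h0 : 0 < Δ) (h1 : Δ ≤ 1/8) (hb : |b| ≤ 1) (hx : 1 ≤ x) (hu : 0 < u) :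
    ‖Complex.exp (-(Complex.I * x * Complex.exp (wP u))) *
      (Complex.exp (AA Δ b (wP u)) - Complex.exp (-Complex.exp (2 * wP u)) - (AA Δ b (wP u) - -Complex.exp (2 * wP u)))‖
      ≤ 16 * K5 * Δ * x ^ (-(2-Δ)) * (1/x + Δ) * Real.exp (-(x/8) * u) := by
  have hx0 : 0 < x := by linarith
  obtain ⟨e1, e2, e3, e4⟩ := u_est h0 h1 hx hu
  set V := 1 + x*u with hVdef
  have hV : 1 ≤ V := by nlinarith
  set X := x ^ (-(2-Δ)) with hX
  have hXp : 0 < X := Real.rpow_pos_of_pos hx0 _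
  have hB : ‖-Complex.exp (2 * wP u)‖ ≤ 2 * V^2 * (x * X) * (1/x + Δ) := by
    rw [norm_neg, norm_z2 hu]
    have : u^2 ≤ V^2 * X := by
      calc u^2 ≤ (V/x)^2 := by gcongr
        _ = V^2 * (1/x^2) := by rw [div_pow]; ring
        _ ≤ _ := by gcongr
    have h6 : 2 * V^2 * (x * X) * (1/x + Δ) = 2 * (V^2 * X) + 2 * Δ * (V^2 * (x*X)) := by
      field_simp
    rw [h6]
    have : 0 ≤ V^2 * X := by positivity
    have : 0 ≤ 2 * Δ * (V^2 * (x*X)) := by positivity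
    linarith
  have h := norm_exp_diff (m := u/8) (by positivity) (AA_re_w h0 h1 hb hu) (B_re_w hu) (norm_A h0 h1 hb hx hu) hB
  have hAB := norm_AB h0 h1 hb hx hu
  rw [norm_mul, norm_ex_w hu]
  calc _ ≤ Real.exp (-(x*u)/2) * (Real.exp (u/8) * (2 * V^2 * (x * X) * (1/x + Δ)) * (8 * Δ * V^3 / x)) := by
        gcongr; exact h.trans (by gcongr)
    _ = (16 * Δ * X * (1/x + Δ)) * (V^5 * (Real.exp (-(x*u)/2) * Real.exp (u/8))) := by field_simp; ring
    _ ≤ (16 * Δ * X * (1/x + Δ)) * (V^5 * Real.exp (-(x*u)/4)) := by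
        gcongr; exact exp_comb hx hu
    _ ≤ (16 * Δ * X * (1/x + Δ)) * (K5 * Real.exp (-((x*u)/8))) := by
        exact mul_le_mul_of_nonneg_left (pow5_le (v := x*u) (by positivity)) (by positivity)
    _ = _ := by
        rw [show -(x/8)*u = -((x*u)/8) by ring]; ring

lemma err_b (h0 : 0 < Δ) (h1 : Δ ≤ 1/8) (hb : |b| ≤ 1) (hx : 1 ≤ x) (hu : 0 < u) :
    ‖Complex.exp (-(Complex.I * x * Complex.exp (wP u))) *
      (Complex.I * (Complex.exp (wP u) - Complex.exp ((2 - Δ) * wP u)) * (Complex.exp (AA Δ b (wP u)) - 1))‖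
      ≤ 16 * K5 * x ^ (-(2-Δ)) * (1/x + Δ) * Real.exp (-(x/8) * u) := by
  have hx0 : 0 < x := by linarith
  obtain ⟨e1, e2, e3, e4⟩ := u_est h0 h1 hx hu
  have hA := norm_A h0 h1 hb hx hu
  set V := 1 + x*u with hVdef
  have hV : 1 ≤ V := by nlinarith
  set X := x ^ (-(2-Δ)) with hX
  have hXp : 0 < X := Real.rpow_pos_of_pos hx0 _
  have hD : ‖Complex.exp (wP u) - Complex.exp ((2 - Δ) * wP u)‖ ≤ 2 * V^2 / x := by
    refine (norm_sub_le _ _).trans ?_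
    rw [norm_P hu, norm_z hu]
    have k1 : u ≤ V^2/x := e1.trans (by gcongr; nlinarith)
    have k2 : u ^ (2-Δ) ≤ V^2 * (1/x) := e2.trans (by gcongr)
    calc u + u ^ (2-Δ) ≤ V^2/x + V^2*(1/x) := by gcongr
      _ = _ := by ring
  have h := norm_exp_sub_one (m := u/8) (by positivity) (AA_re_w h0 h1 hb hu)
  rw [norm_mul, norm_ex_w hu, norm_mul, norm_mul, Complex.norm_I, one_mul]
  calc _ ≤ Real.exp (-(x*u)/2) * ((2 * V^2 / x) * (Real.exp (u/8) * (2 * V^2 * (x * X) * (1/x + Δ)))) := by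
        gcongr; exact h.trans (by gcongr)
    _ = (4 * X * (1/x + Δ)) * (V^4 * (Real.exp (-(x*u)/2) * Real.exp (u/8))) := by field_simp; ring
    _ ≤ (16 * X * (1/x + Δ)) * (V^5 * Real.exp (-(x*u)/4)) := by
        gcongr
        · norm_num
        · norm_num
        · exact exp_comb hx hu
    _ ≤ (16 * X * (1/x + Δ)) * (K5 * Real.exp (-((x*u)/8))) := by
        exact mul_le_mul_of_nonneg_left (pow5_le (v := x*u) (by positivity)) (by positivity)
    _ = _ := by
        rw [show -(x/8)*u = -((x*u)/8) by ring]; ring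

end

lemma err_int {x M : ℝ} (hx : 1 ≤ x) (E : ℝ → ℂ) (hE : Measurable E)
    (h : ∀ u, 0 < u → ‖E u‖ ≤ M * Real.exp (-(x/8) * u)) :
    IntegrableOn E (Ioi 0) ∧ ‖∫ u in Ioi (0:ℝ), E u‖ ≤ M * (8 / x) := by
  have hx0 : 0 < x := by linarith
  have hi : IntegrableOn (fun u : ℝ => M * Real.exp (-(x/8) * u)) (Ioi 0) :=
    (exp_neg_integrableOn_Ioi 0 (show 0 < x/8 by positivity)).const_mul M
  have hae : ∀ᵐ u ∂(volume.restrict (Ioi (0:ℝ))), ‖E u‖ ≤ M * Real.exp (-(x/8) * u) :=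
    (ae_restrict_iff' measurableSet_Ioi).2 (Eventually.of_forall (fun t ht => h t ht))
  refine ⟨hi.mono' hE.aestronglyMeasurable hae, ?_⟩
  refine (norm_integral_le_of_norm_le hi hae).trans_eq ?_
  rw [integral_const_mul, integral_exp_mul_Ioi (by linarith [show 0 < x/8 by positivity])]
  simp

noncomputable def cD (Δ : ℝ) : ℝ := (1/Real.pi) * (Real.Gamma (3 - Δ) * Real.sin (Real.pi * Δ / 2))

lemma tau_cos {Δ : ℝ} (h0 : 0 < Δ) (h1 : Δ ≤ 1/8) :
    tauP Δ * Real.cos (Real.pi * Δ / 2) = Real.sin (Real.pi * Δ / 2) := by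
  unfold tauP
  refine Real.tan_mul_cos (ne_of_gt (Real.cos_pos_of_mem_Ioo ⟨?_, ?_⟩)) <;>
    nlinarith [Real.pi_pos]

lemma exp_th (Δ : ℝ) : Complex.exp (-((Real.pi / 2 * ((2-Δ) + 1) : ℝ) : ℂ) * Complex.I) =
    -(Real.sin (Real.pi * Δ / 2) : ℂ) + (Real.cos (Real.pi * Δ / 2) : ℂ) * Complex.I := by
  rw [show (-((Real.pi / 2 * ((2-Δ) + 1) : ℝ) : ℂ)) = ((Real.pi * Δ/2 + Real.pi/2 - 2 * Real.pi : ℝ) : ℂ) by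
    push_cast; ring]
  rw [Complex.exp_mul_I, ← Complex.ofReal_cos, ← Complex.ofReal_sin, Real.cos_sub_two_pi, Real.sin_sub_two_pi,
    Real.cos_add_pi_div_two, Real.sin_add_pi_div_two]
  push_cast; ring

lemma exp_th1 : Complex.exp (-((Real.pi / 2 * (1 + 1) : ℝ) : ℂ) * Complex.I) = -1 := by
  rw [show (-((Real.pi / 2 * (1 + 1) : ℝ) : ℂ)) * Complex.I = -(Real.pi * Complex.I) by push_cast; ring,
    Complex.exp_neg, Complex.exp_pi_mul_I]; norm_num

lemma exp_th2 : Complex.exp (-((Real.pi / 2 * (2 + 1) : ℝ) : ℂ) * Complex.I) = Complex.I := by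
  have := exp_th 0
  simpa using this

lemma rpow_three {x : ℝ} (hx : 1 ≤ x) (Δ : ℝ) : x ^ (-(2-Δ)) * (1 / x) = x ^ (-(3-Δ)) := by
  have hx0 : 0 < x := by linarith
  rw [one_div, ← Real.rpow_neg_one x, ← Real.rpow_add hx0]; congr 1; ring

lemma one_div_pi_le : 1 / Real.pi ≤ 1 := by
  rw [div_le_one Real.pi_pos]; linarith [Real.pi_gt_three]

section
variable {Δ b x : ℝ}

lemma expan_f (h0 : 0 < Δ) (h1 : Δ ≤ 1/8) (hb : |b| ≤ 1) (hx : 1 ≤ x) :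
    |stableDensity (2-Δ) b x - normalDensity x - cD Δ * (1 + b) * x ^ (-(3-Δ))|
      ≤ 256 * K5 * Δ * x ^ (-(3-Δ)) * (1/x + Δ) := by
  have hx0 : 0 < x := by linarith
  have hK := K5_pos
  rw [stable_sub_normal h0 h1 hb]
  have hr := rayRot (fun w => Hf Δ b x w - Hg x w) ((Hf_diff Δ b x).sub (Hg_diff x)) 0 (Real.pi/6) 1 (2*KK)
    (by positivity) one_pos (fun s φ p1 p2 => by
      have a1 := Hf_bound (s := s) h0 h1 hb hx0.le p1 p2
      have a2 := Hg_bound (s := s) hx0.le p1 p2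
      refine (norm_sub_le _ _).trans ?_
      linarith)
  have hl : (∫ t in Ioi (0:ℝ), (Hf Δ b x (Real.log t) - Hg x (Real.log t))) =
      ∫ u in Ioi (0:ℝ), (Hf Δ b x (wP u) - Hg x (wP u)) * Complex.exp (-((Real.pi/6 : ℝ) : ℂ) * Complex.I) := by
    exact Eq.trans (by simp) hr
  set om : ℂ := Complex.exp (-((Real.pi/6 : ℝ) : ℂ) * Complex.I) with hom
  let E : ℝ → ℂ := fun u => Complex.exp (-(Complex.I * x * Complex.exp (wP u))) *
      (Complex.exp (AA Δ b (wP u)) - Complex.exp (-Complex.exp (2 * wP u)) -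
        (AA Δ b (wP u) - -Complex.exp (2 * wP u))) * om
  have hEm : Measurable E := by
    have := AA_diff Δ b
    exact meas_wP (H := fun w => Complex.exp (-(Complex.I * x * Complex.exp w)) *
      (Complex.exp (AA Δ b w) - Complex.exp (-Complex.exp (2 * w)) -
        (AA Δ b w - -Complex.exp (2 * w))) * om) (by fun_prop)
  obtain ⟨Ei, En⟩ := err_int hx E hEm (M := 16 * K5 * Δ * x ^ (-(2-Δ)) * (1/x + Δ)) (fun u hu => by
    simp only [E]
    rw [norm_mul, hom, norm_om, mul_one]
    exact err_f h0 h1 hb hx hu)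
  have i1 := (monoP_int (p := 2 - Δ) (by linarith) (by linarith) hx0).const_mul (-(1 + Complex.I * b * tauP Δ))
  have i2 := (monoP_int (p := 1) (by linarith) (by linarith) hx0).const_mul (Complex.I * b * tauP Δ)
  have i3 := (monoP_int (p := 2) (by linarith) (by linarith) hx0)
  have hs : ∀ u, (Hf Δ b x (wP u) - Hg x (wP u)) * om =
      E u + ((-(1 + Complex.I * b * tauP Δ)) * monoP (2-Δ) x u + (Complex.I * b * tauP Δ) * monoP 1 x u + monoP 2 x u) := by
    intro u
    simp only [E, Hf, Hg, monoP, AA]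
    push_cast
    rw [hom, one_mul]
    push_cast
    ring
  rw [hl]
  simp_rw [hs]
  have i12 : Integrable (fun u => (-(1 + Complex.I * b * tauP Δ)) * monoP (2-Δ) x u +
      (Complex.I * b * tauP Δ) * monoP 1 x u) (volume.restrict (Ioi 0)) := i1.add i2
  have i123 : Integrable (fun u => (-(1 + Complex.I * b * tauP Δ)) * monoP (2-Δ) x u +
      (Complex.I * b * tauP Δ) * monoP 1 x u + monoP 2 x u) (volume.restrict (Ioi 0)) := i12.add i3
  rw [integral_add Ei i123, integral_add i12 i3, integral_add i1 i2, integral_const_mul,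
    integral_const_mul, monoP_val (by linarith) (by linarith) hx0, monoP_val (by linarith) (by linarith) hx0,
    monoP_val (by linarith) (by linarith) hx0, exp_th, exp_th1, exp_th2]
  have htc := tau_cos h0 h1
  have key : ∀ z : ℂ, (1/Real.pi) * (z + (-(1 + Complex.I * b * tauP Δ) * (((Real.Gamma (2 - Δ + 1) * x ^ (-(2 - Δ + 1)) : ℝ):ℂ) *
      (-(Real.sin (Real.pi * Δ / 2) : ℂ) + (Real.cos (Real.pi * Δ / 2) : ℂ) * Complex.I)) +
      Complex.I * b * tauP Δ * (((Real.Gamma (1 + 1) * x ^ (-(1 + 1:ℝ)) : ℝ):ℂ) * -1) +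
      ((Real.Gamma (2 + 1) * x ^ (-(2 + 1:ℝ)) : ℝ):ℂ) * Complex.I)).re - cD Δ * (1 + b) * x ^ (-(3-Δ)) = (1/Real.pi) * z.re := by
    intro z
    rw [show 2 - Δ + 1 = 3 - Δ by ring]
    unfold cD
    rw [← htc]
    generalize Real.cos (Real.pi * Δ / 2) = cc
    simp
    ring
  rw [key, abs_mul, abs_of_pos (by positivity)]
  have hfin : |(∫ u in Ioi (0:ℝ), E u).re| ≤ _ := (Complex.abs_re_le_norm _).trans En
  have hnn : 0 ≤ |(∫ u in Ioi (0:ℝ), E u).re| := abs_nonneg _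
  have : 16 * K5 * Δ * x ^ (-(2-Δ)) * (1/x + Δ) * (8/x) = 128 * (K5 * Δ * (x ^ (-(2-Δ)) * (1/x)) * (1/x + Δ)) := by ring
  rw [this, rpow_three hx] at hfin
  have hpos : 0 ≤ K5 * Δ * x ^ (-(3-Δ)) * (1/x + Δ) := by
    have := Real.rpow_pos_of_pos hx0 (-(3-Δ)); positivity
  calc _ ≤ 1 * |(∫ u in Ioi (0:ℝ), E u).re| := by gcongr; exact one_div_pi_le
    _ ≤ _ := by linarith

lemma expan_b (h0 : 0 < Δ) (h1 : Δ ≤ 1/8) (hb : |b| < 1) (hx : 1 ≤ x) :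
    |fBeta (2-Δ) b x - cD Δ * x ^ (-(3-Δ))|
      ≤ 256 * K5 * Δ * x ^ (-(3-Δ)) * (1/x + Δ) := by
  have hx0 : 0 < x := by linarith
  have hK := K5_pos
  obtain ⟨t0, t1, -⟩ := tauP_bounds h0 h1
  rw [fBeta_eq h0 h1 hb]
  have hr := rayRot (fun w => Hb Δ b x w) (Hb_diff Δ b x) 0 (Real.pi/6) 1 KK
    (by positivity) one_pos (fun s φ p1 p2 => Hb_bound (s := s) h0 h1 hb.le hx0.le p1 p2)
  have hl : (∫ t in Ioi (0:ℝ), Hb Δ b x (Real.log t)) =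
      ∫ u in Ioi (0:ℝ), Hb Δ b x (wP u) * Complex.exp (-((Real.pi/6 : ℝ) : ℂ) * Complex.I) := by
    exact Eq.trans (by simp) hr
  set om : ℂ := Complex.exp (-((Real.pi/6 : ℝ) : ℂ) * Complex.I) with hom
  let E : ℝ → ℂ := fun u => Complex.exp (-(Complex.I * x * Complex.exp (wP u))) *
      (Complex.I * (Complex.exp (wP u) - Complex.exp ((2 - Δ) * wP u)) * (Complex.exp (AA Δ b (wP u)) - 1)) * om
  have hEm : Measurable E := by
    have := AA_diff Δ b
    exact meas_wP (H := fun w => Complex.exp (-(Complex.I * x * Complex.exp w)) *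
      (Complex.I * (Complex.exp w - Complex.exp ((2 - Δ) * w)) * (Complex.exp (AA Δ b w) - 1)) * om) (by fun_prop)
  obtain ⟨Ei, En⟩ := err_int hx E hEm (M := 16 * K5 * x ^ (-(2-Δ)) * (1/x + Δ)) (fun u hu => by
    simp only [E]
    rw [norm_mul, hom, norm_om, mul_one]
    exact err_b h0 h1 hb.le hx hu)
  have i1 := (monoP_int (p := 2 - Δ) (by linarith) (by linarith) hx0).const_mul (-Complex.I)
  have i2 := (monoP_int (p := 1) (by linarith) (by linarith) hx0).const_mul (Complex.I)
  have hs : ∀ u, Hb Δ b x (wP u) * om =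
      E u + (-Complex.I * monoP (2-Δ) x u + Complex.I * monoP 1 x u) := by
    intro u
    simp only [E, Hb, monoP]
    push_cast
    rw [hom, one_mul]
    push_cast
    ring
  rw [hl]
  simp_rw [hs]
  have i12 : Integrable (fun u => -Complex.I * monoP (2-Δ) x u +
      Complex.I * monoP 1 x u) (volume.restrict (Ioi 0)) := i1.add i2
  rw [integral_add Ei i12, integral_add i1 i2, integral_const_mul,
    integral_const_mul, monoP_val (by linarith) (by linarith) hx0, monoP_val (by linarith) (by linarith) hx0,
    exp_th, exp_th1]
  have htc := tau_cos h0 h1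
  have key : ∀ z : ℂ, (1/Real.pi) * (tauP Δ * (z + (-Complex.I * (((Real.Gamma (2 - Δ + 1) * x ^ (-(2 - Δ + 1)) : ℝ):ℂ) *
      (-(Real.sin (Real.pi * Δ / 2) : ℂ) + (Real.cos (Real.pi * Δ / 2) : ℂ) * Complex.I)) +
      Complex.I * (((Real.Gamma (1 + 1) * x ^ (-(1 + 1:ℝ)) : ℝ):ℂ) * -1))).re) - cD Δ * x ^ (-(3-Δ)) = (1/Real.pi) * (tauP Δ * z.re) := by
    intro z
    rw [show 2 - Δ + 1 = 3 - Δ by ring]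
    unfold cD
    rw [← htc]
    generalize Real.cos (Real.pi * Δ / 2) = cc
    simp
    ring
  rw [key, abs_mul, abs_mul, abs_of_pos (show 0 < 1/Real.pi by positivity), abs_of_pos t0]
  have hfin : |(∫ u in Ioi (0:ℝ), E u).re| ≤ _ := (Complex.abs_re_le_norm _).trans En
  have hnn : 0 ≤ |(∫ u in Ioi (0:ℝ), E u).re| := abs_nonneg _
  have : 16 * K5 * x ^ (-(2-Δ)) * (1/x + Δ) * (8/x) = 128 * (K5 * (x ^ (-(2-Δ)) * (1/x)) * (1/x + Δ)) := by ring
  rw [this, rpow_three hx] at hfin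
  have hpos : 0 ≤ K5 * Δ * x ^ (-(3-Δ)) * (1/x + Δ) := by
    have := Real.rpow_pos_of_pos hx0 (-(3-Δ)); positivity
  calc _ ≤ 1 * ((2 * Δ) * (128 * (K5 * x ^ (-(3-Δ)) * (1/x + Δ)))) := by gcongr; exact one_div_pi_le
    _ = _ := by ring

end

lemma cD_tendsto : Tendsto (fun Δ => cD Δ / Δ) (𝓝[>] 0) (𝓝 1) := by
  have hG : ContinuousAt (fun Δ : ℝ => Real.Gamma (3 - Δ)) 0 := by
    have h3 : ContinuousAt Real.Gamma (3 - 0) :=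
      (Real.differentiableAt_Gamma (fun m => by
        have : (0:ℝ) ≤ m := Nat.cast_nonneg m
        linarith)).continuousAt
    exact ContinuousAt.comp (f := fun Δ : ℝ => 3 - Δ) h3 (by fun_prop)
  have hG2 : Tendsto (fun Δ : ℝ => Real.Gamma (3 - Δ)) (𝓝[>] 0) (𝓝 2) := by
    have := hG.tendsto
    have e : Real.Gamma (3 - 0) = 2 := by
      rw [show (3 - 0 : ℝ) = ((2:ℕ):ℝ) + 1 by norm_num, Real.Gamma_nat_eq_factorial]; norm_num [Nat.factorial]
    rw [e] at this
    exact this.mono_left nhdsWithin_le_nhds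
  have hS : Tendsto (fun Δ : ℝ => Real.sin (Real.pi * Δ / 2) / Δ) (𝓝[>] 0) (𝓝 (Real.pi/2)) := by
    have hd : HasDerivAt (fun Δ : ℝ => Real.sin (Real.pi * Δ / 2)) (Real.pi/2) 0 := by
      have h1 : HasDerivAt (fun Δ : ℝ => Real.pi * Δ / 2) (Real.pi/2) 0 := by
        simpa using ((hasDerivAt_id (0:ℝ)).const_mul Real.pi).div_const 2
      simpa using h1.sin
    have := (hasDerivAt_iff_tendsto_slope.1 hd).mono_left (nhdsWithin_mono 0 (show Ioi (0:ℝ) ⊆ {0}ᶜ by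
      intro y hy; exact ne_of_gt hy))
    refine this.congr (fun y => ?_)
    simp [slope_def_field]
  have := (hG2.mul hS).const_mul (1/Real.pi)
  have e : 1/Real.pi * (2 * (Real.pi/2)) = 1 := by field_simp
  rw [e] at this
  refine this.congr (fun y => ?_)
  unfold cD; ring

lemma nd_pos (x : ℝ) : 0 < normalDensity x := by
  unfold normalDensity
  have := Real.pi_pos
  positivity

lemma nd_anti {x y : ℝ} (hx : 0 ≤ x) (h : x ≤ y) : normalDensity y ≤ normalDensity x := by
  unfold normalDensity
  have := Real.pi_pos
  gcongr

lemma ev_small : ∀ᶠ Δ : ℝ in 𝓝[>] (0:ℝ), 0 < Δ ∧ Δ ≤ 1/8 := by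
  filter_upwards [Ioc_mem_nhdsGT (show (0:ℝ) < 1/8 by norm_num)] with Δ h using h

lemma ev_basic {b : ℝ} (hb : |b| < 1) : ∃ R : ℝ, 1 ≤ R ∧ ∀ᶠ Δ : ℝ in 𝓝[>] (0:ℝ),
    (∀ x, R ≤ x → normalDensity x + (1+b)/2 * Δ * x ^ (-(3-Δ)) ≤ stableDensity (2-Δ) b x ∧
      |fBeta (2-Δ) b x| ≤ 2 * Δ * x ^ (-(3-Δ))) ∧
    (∀ x, 0 ≤ x → x ≤ R → normalDensity R / 2 ≤ stableDensity (2-Δ) b x) := by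
  have hK := K5_pos
  obtain ⟨hb1, hb2⟩ := abs_lt.1 hb
  set C := 256 * K5 with hC
  have hCp : 0 < C := by positivity
  have hk : 0 < 1 + b := by linarith
  refine ⟨1 + 8 * C / (1+b), by have : 0 < 8 * C / (1+b) := by positivity
                                linarith, ?_⟩
  set R := 1 + 8 * C / (1+b) with hR
  have hR1 : 1 ≤ R := by have : 0 < 8 * C / (1+b) := by positivity
                         linarith
  have hc1 : ∀ᶠ Δ : ℝ in 𝓝[>] (0:ℝ), 3/4 < cD Δ / Δ ∧ cD Δ / Δ < 3/2 :=
    cD_tendsto.eventually (Ioo_mem_nhds (by norm_num) (by norm_num))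
  have hc2 : ∀ᶠ Δ : ℝ in 𝓝[>] (0:ℝ), Δ ≤ (1+b)/(8*C) := by
    filter_upwards [Ioc_mem_nhdsGT (show (0:ℝ) < (1+b)/(8*C) by positivity)] with Δ h using h.2
  have hc3 : ∀ᶠ Δ : ℝ in 𝓝[>] (0:ℝ), etaP b Δ < normalDensity R / 2 :=
    (eta_tendsto hb.le).eventually (gt_mem_nhds (by have := nd_pos R; positivity))
  filter_upwards [ev_small, hc1, hc2, hc3] with Δ ⟨h0, h1⟩ ⟨e1, e2⟩ e3 e4
  rw [lt_div_iff₀ h0] at e1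
  rw [div_lt_iff₀ h0] at e2
  refine ⟨fun x hx => ?_, fun x hx hx2 => ?_⟩
  · have hx1 : 1 ≤ x := hR1.trans hx
    have hx0 : 0 < x := by linarith
    have a1 := expan_f h0 h1 hb.le hx1
    have a2 := expan_b h0 h1 hb hx1
    rw [← hC] at a1 a2
    set X := x ^ (-(3-Δ)) with hX
    have hXp : 0 < X := Real.rpow_pos_of_pos hx0 _
    have k1 : C * (1/x) ≤ (1+b)/8 := by
      have : 8 * C / (1+b) ≤ x := by linarith
      rw [div_le_iff₀ hk] at this
      rw [mul_one_div, div_le_iff₀ hx0]; linarith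
    have k2 : C * Δ ≤ (1+b)/8 := by
      rw [le_div_iff₀ (by positivity)] at e3; linarith
    have k3 : C * Δ * X * (1/x + Δ) ≤ (1+b)/4 * (Δ * X) := by
      have : C * (1/x + Δ) ≤ (1+b)/4 := by linarith
      calc C * Δ * X * (1/x + Δ) = C * (1/x + Δ) * (Δ * X) := by ring
        _ ≤ _ := by gcongr
    have hDX : 0 < Δ * X := by positivity
    rw [abs_le] at a1 a2
    have k4 : 3/4 * (1+b) * (Δ * X) ≤ cD Δ * (1+b) * X := by
      calc 3/4 * (1+b) * (Δ * X) = (3/4*Δ) * ((1+b)*X) := by ring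
        _ ≤ cD Δ * ((1+b)*X) := by gcongr
        _ = _ := by ring
    have k5 : cD Δ * X ≤ 3/2 * (Δ * X) := by
      calc cD Δ * X ≤ (3/2 * Δ) * X := by gcongr
        _ = _ := by ring
    have k6 : 0 ≤ cD Δ * X := by
      have : 0 < cD Δ := by linarith [mul_pos (show (0:ℝ) < 3/4 by norm_num) h0]
      positivity
    have k7 : (1+b)/4 * (Δ * X) ≤ 1/2 * (Δ * X) := mul_le_mul_of_nonneg_right (by linarith) hDX.le
    constructor
    · nlinarith [a1.1]
    · rw [abs_le]; constructor <;> nlinarith [a2.1, a2.2]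
  · have := (abs_le.1 (stable_eta h0 h1 hb.le x)).1
    have := nd_anti hx hx2
    linarith

lemma Q_bounds {Δ b R : ℝ} (hb : |b| < 1) (hR : 1 ≤ R) (h0 : 0 < Δ) (h1 : Δ ≤ 1/8)
    (H1 : ∀ x, R ≤ x → normalDensity x + (1+b)/2 * Δ * x ^ (-(3-Δ)) ≤ stableDensity (2-Δ) b x ∧
      |fBeta (2-Δ) b x| ≤ 2 * Δ * x ^ (-(3-Δ)))
    (H2 : ∀ x, 0 ≤ x → x ≤ R → normalDensity R / 2 ≤ stableDensity (2-Δ) b x) :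
    (∀ x, 0 ≤ x → 0 ≤ (fBeta (2-Δ) b x)^2 / stableDensity (2-Δ) b x) ∧
    (∀ x, R ≤ x → (fBeta (2-Δ) b x)^2 / stableDensity (2-Δ) b x ≤ 8/(1+b) * Δ * x ^ (-(3-Δ))) ∧
    (∀ x, R ≤ x → (fBeta (2-Δ) b x)^2 / stableDensity (2-Δ) b x ≤ 8 * Real.sqrt Real.pi * Δ^2 * Real.exp (x^2/4)) ∧
    (∀ x, 0 ≤ x → x ≤ R → (fBeta (2-Δ) b x)^2 / stableDensity (2-Δ) b x ≤ 2 * KK^2 / normalDensity R * Δ^2) := by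
  obtain ⟨hb1, hb2⟩ := abs_lt.1 hb
  have hk : 0 < 1 + b := by linarith
  have hpi : 0 < Real.sqrt Real.pi := Real.sqrt_pos.2 Real.pi_pos
  have hsq : ∀ x, R ≤ x → (fBeta (2-Δ) b x)^2 ≤ (2 * Δ * x ^ (-(3-Δ)))^2 := fun x hx => by
    rw [← sq_abs]; gcongr; exact (H1 x hx).2
  have hXp : ∀ x, R ≤ x → 0 < x ^ (-(3-Δ)) := fun x hx => Real.rpow_pos_of_pos (by linarith) _
  have hpos : ∀ x, R ≤ x → 0 < (1+b)/2 * Δ * x ^ (-(3-Δ)) := fun x hx => by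
    have := hXp x hx; positivity
  refine ⟨fun x hx => ?_, fun x hx => ?_, fun x hx => ?_, fun x hx hx2 => ?_⟩
  · apply div_nonneg (sq_nonneg _)
    rcases le_total R x with h | h
    · have := (H1 x h).1; linarith [hpos x h, nd_pos x]
    · have := H2 x hx h; linarith [nd_pos R]
  · have := hXp x hx
    calc _ ≤ (2 * Δ * x ^ (-(3-Δ)))^2 / ((1+b)/2 * Δ * x ^ (-(3-Δ))) := by
          exact div_le_div₀ (sq_nonneg _) (hsq x hx) (hpos x hx) (by linarith [(H1 x hx).1, nd_pos x])
      _ = _ := by field_simp; ring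
  · have hn := nd_pos x
    have hX1 : x ^ (-(3-Δ)) ≤ 1 := Real.rpow_le_one_of_one_le_of_nonpos (by linarith) (by linarith)
    have := hXp x hx
    calc _ ≤ (2 * Δ * 1)^2 / normalDensity x := by
          refine div_le_div₀ (sq_nonneg _) ((hsq x hx).trans ?_) hn (by linarith [(H1 x hx).1, hpos x hx])
          gcongr
      _ = _ := by
          unfold normalDensity
          rw [show x^2/4 = -(-x^2/4) by ring, Real.exp_neg]
          field_simp; ring
  · have hn := nd_pos R
    have hf := fBeta_le h0 h1 hb x
    calc _ ≤ (KK * Δ)^2 / (normalDensity R / 2) := by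
          rw [← sq_abs]
          gcongr
          exact H2 x hx hx2
      _ = _ := by field_simp

/-- crossover scale -/
noncomputable def sS (Δ : ℝ) : ℝ := 2 * Real.sqrt (Real.log (1/Δ))

lemma sS_atTop : Tendsto sS (𝓝[>] 0) atTop := by
  have h1 : Tendsto (fun Δ : ℝ => 1/Δ) (𝓝[>] 0) atTop := by
    simpa using tendsto_inv_nhdsGT_zero (𝕜 := ℝ)
  exact (Real.tendsto_sqrt_atTop.comp (Real.tendsto_log_atTop.comp h1)).const_mul_atTop (by norm_num)

lemma sS_sq {Δ : ℝ} (h0 : 0 < Δ) (h1 : Δ ≤ 1/8) : (sS Δ)^2 = 4 * Real.log (1/Δ) := by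
  unfold sS
  rw [mul_pow, Real.sq_sqrt]
  · norm_num
  · apply Real.log_nonneg
    rw [le_div_iff₀ h0]; linarith

lemma sS_exp {Δ : ℝ} (h0 : 0 < Δ) (h1 : Δ ≤ 1/8) : Real.exp (-(sS Δ)^2/4) = Δ := by
  rw [sS_sq h0 h1, one_div, Real.log_inv, show -(4 * -Real.log Δ)/4 = Real.log Δ by ring, Real.exp_log h0]

lemma cube_exp {c : ℝ} (hc : 0 < c) : Tendsto (fun s : ℝ => s^3 * Real.exp (-(c * s^2))) atTop (𝓝 0) := by
  have h := Real.tendsto_pow_mul_exp_neg_atTop_nhds_zero 3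
  refine squeeze_zero' ?_ ?_ h
  · filter_upwards [eventually_ge_atTop 0] with s hs
    positivity
  · filter_upwards [eventually_ge_atTop (1/c), eventually_ge_atTop 0] with s hs h0
    gcongr
    rw [div_le_iff₀ hc] at hs
    nlinarith

lemma sS_cube {c : ℝ} (hc : 0 < c) :
    Tendsto (fun Δ : ℝ => (sS Δ)^3 * Real.exp (-(c * (sS Δ)^2))) (𝓝[>] 0) (𝓝 0) :=
  (cube_exp hc).comp sS_atTop

lemma sS_cube_D : Tendsto (fun Δ : ℝ => (sS Δ)^3 * Δ) (𝓝[>] 0) (𝓝 0) := by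
  refine (sS_cube (show (0:ℝ) < 1/4 by norm_num)).congr' ?_
  filter_upwards [ev_small] with Δ ⟨h0, h1⟩
  rw [show -(1/4 * (sS Δ)^2) = -(sS Δ)^2/4 by ring, sS_exp h0 h1]

lemma sS_rpow : Tendsto (fun Δ : ℝ => (sS Δ)^Δ) (𝓝[>] 0) (𝓝 1) := by
  have h : Tendsto (fun Δ : ℝ => Real.log (sS Δ) * Δ) (𝓝[>] 0) (𝓝 0) := by
    refine squeeze_zero' ?_ ?_ sS_cube_D
    · filter_upwards [ev_small, sS_atTop.eventually_ge_atTop 1] with Δ ⟨h0, h1⟩ h2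
      have := Real.log_nonneg h2
      positivity
    · filter_upwards [ev_small, sS_atTop.eventually_ge_atTop 1] with Δ ⟨h0, h1⟩ h2
      have := Real.log_le_sub_one_of_pos (show 0 < sS Δ by linarith)
      gcongr
      have : sS Δ ≤ (sS Δ)^3 := le_self_pow₀ h2 (by norm_num)
      linarith
  have := (Real.continuous_exp.tendsto 0).comp h
  rw [Real.exp_zero] at this
  refine this.congr' ?_
  filter_upwards [sS_atTop.eventually_ge_atTop 1] with Δ h2
  simp [Real.rpow_def_of_pos (show 0 < sS Δ by linarith)]

lemma X_split {s y Δ : ℝ} (hs : 0 < s) (hy : 0 < y) :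
    s^3 * (s*y) ^ (-(3-Δ)) = s^Δ * y ^ (-(3-Δ)) := by
  rw [Real.mul_rpow hs.le hy.le, ← mul_assoc]
  congr 1
  rw [← Real.rpow_natCast s 3, ← Real.rpow_add hs]
  congr 1; push_cast; ring

noncomputable def Qf (Δ b x : ℝ) : ℝ := (fBeta (2-Δ) b x)^2 / stableDensity (2-Δ) b x

noncomputable def gF (b Δ y : ℝ) : ℝ := (sS Δ)^3 / (4 * Δ) * Qf Δ b (sS Δ * y)

noncomputable def domF (b y : ℝ) : ℝ :=
  (Ioc (0:ℝ) (1/2)).indicator (fun _ => (1:ℝ)) y + (Ioi (1/2:ℝ)).indicator (fun y => 8/(1+b) * y ^ (-(5/2:ℝ))) y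

lemma domF_int (b : ℝ) : Integrable (domF b) := by
  unfold domF
  refine Integrable.add ?_ ?_
  · exact (integrable_indicator_iff measurableSet_Ioc).2 (by simp)
  · exact (integrable_indicator_iff measurableSet_Ioi).2
      ((integrableOn_Ioi_rpow_of_lt (by norm_num) (by norm_num)).const_mul _)

lemma Qf_meas {Δ b : ℝ} (h0 : 0 < Δ) (h1 : Δ ≤ 1/8) (hb : |b| < 1) : Measurable (Qf Δ b) :=
  ((cont_Hb h0 h1 hb).measurable.pow_const 2).div (cont_Hf h0 h1 hb.le).measurable

lemma ypow {y Δ : ℝ} (h0 : 0 < Δ) (h1 : Δ ≤ 1/8) (hy : 1/2 < y) :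
    y ^ (-(3-Δ)) ≤ 2 * y ^ (-(5/2:ℝ)) := by
  have hy0 : 0 < y := by linarith
  have e : y ^ (-(3-Δ)) = y ^ (-(1/2-Δ)) * y ^ (-(5/2:ℝ)) := by
    rw [← Real.rpow_add hy0]; congr 1; ring
  rw [e]
  gcongr
  calc y ^ (-(1/2-Δ)) ≤ (1/2:ℝ) ^ (-(1/2-Δ)) :=
        Real.rpow_le_rpow_of_nonpos (by norm_num) hy.le (by linarith)
    _ ≤ (1/2:ℝ) ^ (-1:ℝ) := Real.rpow_le_rpow_of_exponent_ge (by norm_num) (by norm_num) (by linarith)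
    _ = 2 := by rw [Real.rpow_neg_one]; norm_num

lemma gF_small {b : ℝ} {y Δ : ℝ} (h0 : 0 < Δ) (h1 : Δ ≤ 1/8) (hs : 0 < sS Δ)
    (h : Qf Δ b (sS Δ * y) ≤ 8 * Real.sqrt Real.pi * Δ^2 * Real.exp ((sS Δ * y)^2/4)) :
    gF b Δ y ≤ 2 * Real.sqrt Real.pi * ((sS Δ)^3 * Real.exp (-((1 - y^2)/4 * (sS Δ)^2))) := by
  unfold gF
  calc _ ≤ (sS Δ)^3 / (4 * Δ) * (8 * Real.sqrt Real.pi * Δ^2 * Real.exp ((sS Δ * y)^2/4)) := by gcongr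
    _ = 2 * Real.sqrt Real.pi * ((sS Δ)^3 * (Δ * Real.exp ((sS Δ * y)^2/4))) := by field_simp; ring
    _ = _ := by
      nth_rewrite 2 [← sS_exp h0 h1]
      rw [← Real.exp_add]
      congr 4; ring

lemma gF_dom {b : ℝ} (hb : |b| < 1) : ∀ᶠ Δ : ℝ in 𝓝[>] (0:ℝ), ∀ y, 0 < y → ‖gF b Δ y‖ ≤ domF b y := by
  obtain ⟨R, hR, hev⟩ := ev_basic hb
  obtain ⟨hb1, hb2⟩ := abs_lt.1 hb
  have hk : 0 < 1 + b := by linarith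
  have hn := nd_pos R
  have c1 : ∀ᶠ Δ : ℝ in 𝓝[>] (0:ℝ), (sS Δ)^Δ < 2 := sS_rpow.eventually (gt_mem_nhds (by norm_num))
  have c2 : ∀ᶠ Δ : ℝ in 𝓝[>] (0:ℝ), KK^2 / (2 * normalDensity R) * ((sS Δ)^3 * Δ) < 1 := by
    have := sS_cube_D.const_mul (KK^2 / (2 * normalDensity R))
    rw [mul_zero] at this
    exact this.eventually (gt_mem_nhds (by norm_num))
  have c3 : ∀ᶠ Δ : ℝ in 𝓝[>] (0:ℝ),
      2 * Real.sqrt Real.pi * ((sS Δ)^3 * Real.exp (-(3/16 * (sS Δ)^2))) < 1 := by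
    have := (sS_cube (show (0:ℝ) < 3/16 by norm_num)).const_mul (2 * Real.sqrt Real.pi)
    rw [mul_zero] at this
    exact this.eventually (gt_mem_nhds (by norm_num))
  filter_upwards [ev_small, hev, c1, c2, c3, sS_atTop.eventually_ge_atTop (2*R)] with Δ ⟨h0, h1⟩ ⟨H1, H2⟩ k1 k2 k3 k4 y hy
  obtain ⟨q0, q1, q2, q3⟩ := Q_bounds hb hR h0 h1 H1 H2
  have hs : 0 < sS Δ := by linarith
  have hx : 0 ≤ sS Δ * y := by positivity
  have hg0 : 0 ≤ gF b Δ y := by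
    have : 0 ≤ Qf Δ b (sS Δ * y) := q0 _ hx
    unfold gF; positivity
  rw [Real.norm_of_nonneg hg0]
  unfold domF
  rcases le_or_gt y (1/2) with h | h
  · rw [indicator_of_mem (show y ∈ Ioc (0:ℝ) (1/2) from ⟨hy, h⟩),
      indicator_of_notMem (show y ∉ Ioi (1/2:ℝ) from not_lt.2 h), add_zero]
    rcases le_total R (sS Δ * y) with hh | hh
    · refine (gF_small h0 h1 hs (q2 _ hh)).trans (le_trans ?_ k3.le)
      have hy2 : 3/16 ≤ (1 - y^2)/4 := by nlinarith
      gcongr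
    · have : Qf Δ b (sS Δ * y) ≤ _ := q3 _ hx hh
      refine le_trans ?_ k2.le
      unfold gF
      calc _ ≤ (sS Δ)^3 / (4 * Δ) * (2 * KK^2 / normalDensity R * Δ^2) := by gcongr
        _ = _ := by field_simp; ring
  · rw [indicator_of_notMem (show y ∉ Ioc (0:ℝ) (1/2) from fun hc => not_lt.2 hc.2 h),
      indicator_of_mem (show y ∈ Ioi (1/2:ℝ) from h), zero_add]
    have hh : R ≤ sS Δ * y := by nlinarith
    have : Qf Δ b (sS Δ * y) ≤ _ := q1 _ hh
    unfold gF
    have hyp : 0 < y ^ (-(3-Δ)) := Real.rpow_pos_of_pos hy _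
    calc _ ≤ (sS Δ)^3 / (4 * Δ) * (8/(1+b) * Δ * (sS Δ * y) ^ (-(3-Δ))) := by gcongr
      _ = 2/(1+b) * ((sS Δ)^3 * (sS Δ * y) ^ (-(3-Δ))) := by field_simp; ring
      _ = 2/(1+b) * ((sS Δ)^Δ * y ^ (-(3-Δ))) := by rw [X_split hs hy]
      _ ≤ 2/(1+b) * (2 * (2 * y ^ (-(5/2:ℝ)))) := by gcongr; exact ypow h0 h1 h
      _ = _ := by ring

lemma gF_lim_lt {b y : ℝ} (hb : |b| < 1) (hy : 0 < y) (hy1 : y < 1) :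
    Tendsto (fun Δ => gF b Δ y) (𝓝[>] 0) (𝓝 0) := by
  obtain ⟨R, hR, hev⟩ := ev_basic hb
  have hc : 0 < (1 - y^2)/4 := by nlinarith
  have := (sS_cube hc).const_mul (2 * Real.sqrt Real.pi)
  rw [mul_zero] at this
  have hx : ∀ᶠ Δ : ℝ in 𝓝[>] (0:ℝ), R ≤ sS Δ * y := (sS_atTop.atTop_mul_const hy).eventually_ge_atTop R
  refine squeeze_zero' ?_ ?_ this
  · filter_upwards [ev_small, hev, hx, sS_atTop.eventually_gt_atTop 0] with Δ ⟨h0, h1⟩ ⟨H1, H2⟩ hh hs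
    obtain ⟨q0, q1, q2, q3⟩ := Q_bounds hb hR h0 h1 H1 H2
    have : 0 ≤ Qf Δ b (sS Δ * y) := q0 _ (by positivity)
    unfold gF; positivity
  · filter_upwards [ev_small, hev, hx, sS_atTop.eventually_gt_atTop 0] with Δ ⟨h0, h1⟩ ⟨H1, H2⟩ hh hs
    obtain ⟨q0, q1, q2, q3⟩ := Q_bounds hb hR h0 h1 H1 H2
    exact gF_small h0 h1 hs (q2 _ hh)

lemma gF_lim_gt {b y : ℝ} (hb : |b| < 1) (hy1 : 1 < y) :
    Tendsto (fun Δ => gF b Δ y) (𝓝[>] 0) (𝓝 (1/(4*(1+b)) * y ^ (-3:ℝ))) := by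
  have hy : 0 < y := by linarith
  obtain ⟨hb1, hb2⟩ := abs_lt.1 hb
  have hk : 0 < 1 + b := by linarith
  have hK := K5_pos
  have hid : Tendsto (fun Δ : ℝ => Δ) (𝓝[>] 0) (𝓝 0) := tendsto_nhdsWithin_of_tendsto_nhds tendsto_id
  have hx1 : ∀ᶠ Δ : ℝ in 𝓝[>] (0:ℝ), 1 ≤ sS Δ * y := (sS_atTop.atTop_mul_const hy).eventually_ge_atTop 1
  -- error scale
  have herr : Tendsto (fun Δ : ℝ => 256 * K5 * (1/(sS Δ * y) + Δ)) (𝓝[>] 0) (𝓝 0) := by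
    have h1 : Tendsto (fun Δ : ℝ => 1/(sS Δ * y)) (𝓝[>] 0) (𝓝 0) := by
      have := tendsto_inv_atTop_zero.comp (sS_atTop.atTop_mul_const hy)
      exact this.congr (fun Δ => by simp [Function.comp])
    simpa using (h1.add hid).const_mul (256 * K5)
  have hX : Tendsto (fun Δ : ℝ => (sS Δ)^3 * (sS Δ * y) ^ (-(3-Δ))) (𝓝[>] 0) (𝓝 (y ^ (-3:ℝ))) := by
    have h1 : Tendsto (fun Δ : ℝ => y ^ (-(3-Δ))) (𝓝[>] 0) (𝓝 (y ^ (-3:ℝ))) := by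
      have h2 : Tendsto (fun Δ : ℝ => -(3-Δ)) (𝓝[>] 0) (𝓝 (-3)) := by
        simpa using (hid.const_sub 3).neg
      exact ((Real.continuous_const_rpow hy.ne').tendsto (-3)).comp h2
    have := sS_rpow.mul h1
    rw [one_mul] at this
    refine this.congr' ?_
    filter_upwards [sS_atTop.eventually_gt_atTop 0] with Δ hs
    rw [X_split hs hy]
  -- fBeta ratio
  have hB : Tendsto (fun Δ : ℝ => fBeta (2-Δ) b (sS Δ * y) / (Δ * (sS Δ * y) ^ (-(3-Δ)))) (𝓝[>] 0) (𝓝 1) := by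
    have hz : Tendsto (fun Δ : ℝ => fBeta (2-Δ) b (sS Δ * y) / (Δ * (sS Δ * y) ^ (-(3-Δ))) - cD Δ / Δ) (𝓝[>] 0) (𝓝 0) := by
      refine squeeze_zero_norm' ?_ herr
      filter_upwards [ev_small, hx1] with Δ ⟨h0, h1⟩ hx
      have hXp : 0 < (sS Δ * y) ^ (-(3-Δ)) := Real.rpow_pos_of_pos (by linarith) _
      have h := expan_b h0 h1 hb hx
      have e : fBeta (2-Δ) b (sS Δ * y) / (Δ * (sS Δ * y) ^ (-(3-Δ))) - cD Δ / Δ =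
        (fBeta (2-Δ) b (sS Δ * y) - cD Δ * (sS Δ * y) ^ (-(3-Δ))) / (Δ * (sS Δ * y) ^ (-(3-Δ))) := by
        field_simp
      rw [e, Real.norm_eq_abs, abs_div, abs_of_pos (show 0 < Δ * (sS Δ * y) ^ (-(3-Δ)) by positivity),
        div_le_iff₀ (by positivity)]
      refine h.trans_eq ?_
      ring
    have := hz.add cD_tendsto
    rw [zero_add] at this
    exact this.congr (fun Δ => by ring)
  have hN : Tendsto (fun Δ : ℝ => normalDensity (sS Δ * y) / (Δ * (sS Δ * y) ^ (-(3-Δ)))) (𝓝[>] 0) (𝓝 0) := by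
    have hc : 0 < (y^2 - 1)/4 := by nlinarith
    have h1 := ((sS_cube hc).const_mul (1/(2*Real.sqrt Real.pi))).div hX (Real.rpow_pos_of_pos hy _).ne'
    rw [mul_zero, zero_div] at h1
    refine h1.congr' ?_
    filter_upwards [ev_small, hx1, sS_atTop.eventually_gt_atTop 0] with Δ ⟨h0, h1⟩ hx hs
    have hXp : 0 < (sS Δ * y) ^ (-(3-Δ)) := Real.rpow_pos_of_pos (by linarith) _
    have e : Real.exp (-((y^2 - 1)/4 * (sS Δ)^2)) = Real.exp (-(sS Δ * y)^2/4) / Δ := by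
      nth_rewrite 3 [← sS_exp h0 h1]
      rw [← Real.exp_sub]; congr 1; ring
    simp only [Pi.div_apply]
    rw [e]
    unfold normalDensity
    field_simp
  have hF : Tendsto (fun Δ : ℝ => stableDensity (2-Δ) b (sS Δ * y) / (Δ * (sS Δ * y) ^ (-(3-Δ)))) (𝓝[>] 0) (𝓝 (1+b)) := by
    have hz : Tendsto (fun Δ : ℝ => stableDensity (2-Δ) b (sS Δ * y) / (Δ * (sS Δ * y) ^ (-(3-Δ))) -
        normalDensity (sS Δ * y) / (Δ * (sS Δ * y) ^ (-(3-Δ))) - cD Δ / Δ * (1+b)) (𝓝[>] 0) (𝓝 0) := by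
      refine squeeze_zero_norm' ?_ herr
      filter_upwards [ev_small, hx1] with Δ ⟨h0, h1⟩ hx
      have hXp : 0 < (sS Δ * y) ^ (-(3-Δ)) := Real.rpow_pos_of_pos (by linarith) _
      have h := expan_f h0 h1 hb.le hx
      have e : stableDensity (2-Δ) b (sS Δ * y) / (Δ * (sS Δ * y) ^ (-(3-Δ))) -
        normalDensity (sS Δ * y) / (Δ * (sS Δ * y) ^ (-(3-Δ))) - cD Δ / Δ * (1+b) =
        (stableDensity (2-Δ) b (sS Δ * y) - normalDensity (sS Δ * y) - cD Δ * (1+b) * (sS Δ * y) ^ (-(3-Δ))) / (Δ * (sS Δ * y) ^ (-(3-Δ))) := by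
        field_simp
      rw [e, Real.norm_eq_abs, abs_div, abs_of_pos (show 0 < Δ * (sS Δ * y) ^ (-(3-Δ)) by positivity),
        div_le_iff₀ (by positivity)]
      refine h.trans_eq ?_
      ring
    have := (hz.add hN).add (cD_tendsto.mul_const (1+b))
    rw [zero_add, zero_add, one_mul] at this
    exact this.congr (fun Δ => by ring)
  have hall := ((hX.div_const 4).mul (hB.pow 2)).div hF hk.ne'
  have e : y ^ (-3:ℝ) / 4 * 1^2 / (1+b) = 1/(4*(1+b)) * y ^ (-3:ℝ) := by field_simp
  rw [e] at hall
  refine hall.congr' ?_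
  filter_upwards [ev_small, hx1] with Δ ⟨h0, h1⟩ hx
  have hXp : 0 < (sS Δ * y) ^ (-(3-Δ)) := Real.rpow_pos_of_pos (by linarith) _
  unfold gF Qf
  simp only [Pi.div_apply]
  by_cases hf : stableDensity (2-Δ) b (sS Δ * y) = 0
  · simp [hf]
  · field_simp

lemma half_lim {b : ℝ} (hb : |b| < 1) :
    Tendsto (fun Δ => ∫ y in Ioi (0:ℝ), gF b Δ y) (𝓝[>] 0) (𝓝 (1/(8*(1+b)))) := by
  obtain ⟨hb1, hb2⟩ := abs_lt.1 hb
  have hk : 0 < 1 + b := by linarith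
  have hlim : ∫ y in Ioi (0:ℝ), (Ioi (1:ℝ)).indicator (fun y => 1/(4*(1+b)) * y ^ (-3:ℝ)) y = 1/(8*(1+b)) := by
    rw [setIntegral_indicator measurableSet_Ioi,
      inter_eq_self_of_subset_right (Ioi_subset_Ioi zero_le_one), integral_const_mul,
      integral_Ioi_rpow_of_lt (by norm_num) (by norm_num)]
    norm_num
    field_simp; norm_num
  rw [← hlim]
  refine tendsto_integral_filter_of_dominated_convergence (domF b) ?_ ?_ (domF_int b).integrableOn ?_
  · filter_upwards [ev_small] with Δ ⟨h0, h1⟩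
    unfold gF
    exact (((Qf_meas h0 h1 hb).comp (measurable_const_mul _)).const_mul _).aestronglyMeasurable
  · filter_upwards [gF_dom hb] with Δ h
    exact (ae_restrict_iff' measurableSet_Ioi).2 (Eventually.of_forall (fun y hy => h y hy))
  · have h1 : ∀ᵐ y : ℝ, y ≠ 1 := by simp [ae_iff]
    refine (ae_restrict_iff' measurableSet_Ioi).2 (h1.mono (fun y hne hy => ?_))
    rcases lt_or_gt_of_ne hne with h | h
    · rw [indicator_of_notMem (show y ∉ Ioi (1:ℝ) from not_lt.2 h.le)]
      exact gF_lim_lt hb hy h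
    · rw [indicator_of_mem (show y ∈ Ioi (1:ℝ) from h)]
      exact gF_lim_gt hb h

lemma half_int {b : ℝ} (hb : |b| < 1) : ∀ᶠ Δ : ℝ in 𝓝[>] (0:ℝ), IntegrableOn (Qf Δ b) (Ioi 0) := by
  filter_upwards [ev_small, gF_dom hb, sS_atTop.eventually_gt_atTop 0] with Δ ⟨h0, h1⟩ h hs
  have hg : IntegrableOn (gF b Δ) (Ioi 0) := by
    refine (domF_int b).integrableOn.mono' ?_
      ((ae_restrict_iff' measurableSet_Ioi).2 (Eventually.of_forall (fun y hy => h y hy)))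
    unfold gF
    exact (((Qf_meas h0 h1 hb).comp (measurable_const_mul _)).const_mul _).aestronglyMeasurable
  have h2 : IntegrableOn (fun y => Qf Δ b (sS Δ * y)) (Ioi 0) := by
    have := hg.const_mul ((sS Δ)^3 / (4 * Δ))⁻¹
    refine this.congr (Eventually.of_forall fun y => ?_)
    simp only [gF]
    rw [← mul_assoc, inv_mul_cancel₀ (by positivity), one_mul]
  have := (integrableOn_Ioi_comp_mul_left_iff (Qf Δ b) 0 hs).1 h2
  simpa using this

lemma half_scale {Δ b : ℝ} (h0 : 0 < Δ) (h1 : Δ ≤ 1/8) (hs : 0 < sS Δ) :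
    ∫ y in Ioi (0:ℝ), gF b Δ y = Real.log (1/Δ) / Δ * ∫ x in Ioi (0:ℝ), Qf Δ b x := by
  unfold gF
  rw [integral_const_mul, integral_comp_mul_left_Ioi (Qf Δ b) 0 hs, mul_zero, smul_eq_mul]
  have := sS_sq h0 h1
  have e : Real.log (1/Δ) = (sS Δ)^2/4 := by linarith
  rw [e]
  field_simp

theorem fisher_information_beta_beta (β : ℝ) (hβ : β ∈ Set.Ioo (-1 : ℝ) 1) :
    Filter.Tendsto
      (fun Δ : ℝ => (4 * (1 - β ^ 2) * Real.log (1 / Δ) / Δ) *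
        ∫ x : ℝ, (fBeta (2 - Δ) β x) ^ 2 / stableDensity (2 - Δ) β x)
      (nhdsWithin 0 (Set.Ioi 0)) (nhds 1) := by
  have hb : |β| < 1 := abs_lt.2 hβ
  have hb' : |-β| < 1 := by rwa [abs_neg]
  have h1 : 0 < 1 + β := by linarith [hβ.1]
  have h2 : 0 < 1 + -β := by linarith [hβ.2]
  have h := ((half_lim hb).add (half_lim hb')).const_mul (4 * (1 - β^2))
  have e : 4 * (1 - β^2) * (1/(8*(1+β)) + 1/(8*(1+-β))) = 1 := by
    field_simp; ring
  rw [e] at h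
  refine h.congr' ?_
  filter_upwards [ev_small, half_int hb, half_int hb', sS_atTop.eventually_gt_atTop 0] with Δ ⟨h0, h1⟩ i1 i2 hs
  rw [half_scale h0 h1 hs, half_scale h0 h1 hs]
  have hneg : ∀ x, Qf Δ β (-x) = Qf Δ (-β) x := by
    intro x
    unfold Qf
    rw [fBeta_neg, stable_neg, neg_sq]
  have hI : ∫ x in Iic (0:ℝ), Qf Δ β x = ∫ x in Ioi (0:ℝ), Qf Δ (-β) x := by
    have := integral_comp_neg_Ioi (0:ℝ) (Qf Δ β)
    rw [neg_zero] at this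
    rw [← this]
    simp_rw [hneg]
  have i3 : IntegrableOn (Qf Δ β) (Iic 0) := by
    have : IntegrableOn (fun x => Qf Δ β (-x)) (Ioi 0) := by simp_rw [hneg]; exact i2
    rw [integrableOn_Iic_iff_integrableOn_Iio]
    have h5 := (Measure.measurePreserving_neg (volume : Measure ℝ)).integrableOn_comp_preimage
      (Homeomorph.neg ℝ).measurableEmbedding (f := Qf Δ β) (s := Iio 0)
    rw [← h5]
    simpa [Function.comp_def] using this
  have hT : ∫ x : ℝ, (fBeta (2 - Δ) β x) ^ 2 / stableDensity (2 - Δ) β x =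
      (∫ x in Iic (0:ℝ), Qf Δ β x) + ∫ x in Ioi (0:ℝ), Qf Δ β x :=
    (intervalIntegral.integral_Iic_add_Ioi i3 i1).symm
  rw [hT, hI]
  ring
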